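/- arXiv:math/0611543 — 5 statements merged into one kernel-verified Lean document; each statement's English description precedes it below -/
import Mathlib

section
/- If η′(a₀) + 8η′(2a₀) > 0, then the Jacobian matrix DΨ̂^F(a₀) at the uniform vector a₀ = (a₀,…,a₀) ∈ ℝ^{2N+1} is strictly diagonally dominant with positive diagonal entries (each diagonal entry strictly exceeds the sum of the absolute values of the off-diagonal entries in its row), hence invertible; consequently there exist open neighborhoods U of a₀ and V of 0 = Ψ̂^F(a₀) such that Ψ̂^F restricts to a bijection from U onto V. -/
open Finset Set

noncomputable section

/-- The `j`-th component (for `j ∈ [-N, N]`) of a vector in `ℝ^{2N+1}`. -/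
def vcomp (N : ℕ) (r : Fin (2*N+1) → ℝ) (j : ℤ) : ℝ :=
  if h : (j + N).toNat < 2*N+1 then r ⟨(j + N).toNat, h⟩ else 0

/-- `η̂(r) = η(r) + 2 η(2r)`, the derivative of the energy density. -/
def etaHat (η : ℝ → ℝ) : ℝ → ℝ := fun r => η r + 2 * η (2*r)

/-- Structural assumptions on the atomistic potential (with `η = φ'`). -/
def Assump (η : ℝ → ℝ) (r1 r2 a0 a1 : ℝ) : Prop :=
  0 < a0 ∧ a0 < r1 ∧ r1 < r2 ∧ r2 < 2*a0 ∧ a0 < a1 ∧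
  (∀ r ∈ Ioo (0:ℝ) r1, 0 < deriv η r) ∧ (∀ r ∈ Ioi r1, deriv η r < 0) ∧
  (∀ r ∈ Ioo (0:ℝ) r2, deriv (deriv η) r < 0) ∧ (∀ r ∈ Ioi r2, 0 < deriv (deriv η) r) ∧
  (∀ r ∈ Ioo (0:ℝ) a0, etaHat η r < 0) ∧ (∀ r ∈ Ioi a0, 0 < etaHat η r) ∧
  (∀ r ∈ Ioo (0:ℝ) a1, 0 < deriv (etaHat η) r) ∧ (∀ r ∈ Ioi a1, deriv (etaHat η) r < 0)

/-- The symmetrized force-based quasicontinuum conjugate-force map `Ψ̂^F`. -/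
def PsiF (N K : ℕ) (η : ℝ → ℝ) (r : Fin (2*N+1) → ℝ) : Fin (2*N+1) → ℝ := fun i =>
  let j : ℤ := (i.val : ℤ) - (N : ℤ)
  let c := vcomp N r
  if -(K:ℤ)+1 ≤ j ∧ j ≤ (K:ℤ)-1 then
    η (c j) + η (c j + c (j-1)) + η (c j + c (j+1))
      + 2 * η (2 * c (K:ℤ)) - η (c (K:ℤ) + c ((K:ℤ)-1)) - η (c (K:ℤ) + c ((K:ℤ)+1))
  else η (c j) + 2 * η (2 * c j)

/-- The symmetrized energy-based quasicontinuum conjugate-force map `Ψ̂^E`. -/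
def PsiE (N K : ℕ) (η : ℝ → ℝ) (r : Fin (2*N+1) → ℝ) : Fin (2*N+1) → ℝ := fun i =>
  let j : ℤ := (i.val : ℤ) - (N : ℤ)
  let c := vcomp N r
  if j = -(K:ℤ)-1 then η (c j) + 2*η (2*c j) + (1/2)*η (c j + c (j+1))
  else if j = (K:ℤ)+1 then η (c j) + 2*η (2*c j) + (1/2)*η (c (j-1) + c j)
  else if j = -(K:ℤ) ∨ j = (K:ℤ) then
    η (c j) + η (2*c j) + (1/2)*η (c j + c (j-1)) + (1/2)*η (c j + c (j+1))
  else if j = -(K:ℤ)+1 then η (c j) + (1/2)*η (c j + c (j-1)) + η (c j + c (j+1))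
  else if j = (K:ℤ)-1 then η (c j) + η (c j + c (j-1)) + (1/2)*η (c j + c (j+1))
  else if -(K:ℤ)+2 ≤ j ∧ j ≤ (K:ℤ)-2 then η (c j) + η (c j + c (j-1)) + η (c j + c (j+1))
  else η (c j) + 2*η (2*c j)

/-- The ghost-force correction map `Ψ̂^G = Ψ̂^F - Ψ̂^E`. -/
def PsiG (N K : ℕ) (η : ℝ → ℝ) (r : Fin (2*N+1) → ℝ) : Fin (2*N+1) → ℝ :=
  fun i => PsiF N K η r i - PsiE N K η r i

/-- The force-based quasicontinuum forces, with `r` given as a `ℤ`-indexed family. -/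
def FQCFr (N K : ℕ) (η : ℝ → ℝ) (r : ℤ → ℝ) (j : ℤ) : ℝ :=
  if j = -(N:ℤ) then η (r j) + 2*η (2*r j)
  else if j = (N:ℤ)+1 then -(η (r (j-1)) + 2*η (2*r (j-1)))
  else if -(K:ℤ)+1 ≤ j ∧ j ≤ (K:ℤ) then
    (η (r j) + η (r j + r (j+1))) - (η (r (j-1)) + η (r (j-1) + r (j-2)))
  else (η (r j) + 2*η (2*r j)) - (η (r (j-1)) + 2*η (2*r (j-1)))

/-- The Jacobian matrix of `Ψ̂^F`. -/
def Jac (N K : ℕ) (η : ℝ → ℝ) (r : Fin (2*N+1) → ℝ) :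
    Matrix (Fin (2*N+1)) (Fin (2*N+1)) ℝ :=
  fun i j => deriv (fun t => PsiF N K η (Function.update r j t) i) (r j)

/-- Strict diagonal dominance with positive diagonal. -/
def SDD {m : ℕ} (A : Matrix (Fin m) (Fin m) ℝ) : Prop :=
  ∀ i, 0 < A i i ∧ ∑ j ∈ Finset.univ.erase i, |A i j| < A i i

/-- A vector `r ∈ ℝ^{2N+1}` is symmetric if `r_{-j} = r_j` for `1 ≤ j ≤ N`. -/
def SymVec (N : ℕ) (r : Fin (2*N+1) → ℝ) : Prop :=
  ∀ j : ℤ, 1 ≤ j → j ≤ (N:ℤ) → vcomp N r (-j) = vcomp N r j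

lemma vcomp_sub_natCast (N : ℕ) (i : Fin (2*N+1)) (r : Fin (2*N+1) → ℝ) :
    vcomp N r ((i.val : ℤ) - N) = r i := by
  have h : ¬ 2*N < i.val := by omega
  simp [vcomp, h]

lemma exists_vcomp_eq_apply (N : ℕ) (j : ℤ) (h₁ : -(N:ℤ) ≤ j) (h₂ : j ≤ N) :
    ∃ k : Fin (2*N+1), ∀ r, vcomp N r j = r k := by
  have h : (j + N).toNat < 2*N+1 := by omega
  exact ⟨⟨(j + N).toNat, h⟩, fun r => by simp [vcomp, h]⟩

/-- Each component of `Ψ̂^F` is of atomistic or of continuum type. -/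
lemma psiF_apply_cases (N K : ℕ) (hKN : K + 2 ≤ N) (η : ℝ → ℝ) (i : Fin (2*N+1)) :
    (∃ a b c d e : Fin (2*N+1), ∀ r, PsiF N K η r i =
      η (r i) + η (r i + r a) + η (r i + r b) + 2 * η (2 * r c)
        - η (r c + r d) - η (r c + r e)) ∨
    ∀ r, PsiF N K η r i = η (r i) + 2 * η (2 * r i) := by
  by_cases h : -(K:ℤ)+1 ≤ (i.val : ℤ) - N ∧ (i.val : ℤ) - N ≤ (K:ℤ)-1
  · left
    obtain ⟨a, ha⟩ := exists_vcomp_eq_apply N ((i.val : ℤ) - N - 1) (by omega) (by omega)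
    obtain ⟨b, hb⟩ := exists_vcomp_eq_apply N ((i.val : ℤ) - N + 1) (by omega) (by omega)
    obtain ⟨c, hc⟩ := exists_vcomp_eq_apply N (K : ℤ) (by omega) (by omega)
    obtain ⟨d, hd⟩ := exists_vcomp_eq_apply N ((K : ℤ) - 1) (by omega) (by omega)
    obtain ⟨e, he⟩ := exists_vcomp_eq_apply N ((K : ℤ) + 1) (by omega) (by omega)
    refine ⟨a, b, c, d, e, fun r => ?_⟩
    simp only [PsiF, if_pos h, ha, hb, hc, hd, he, vcomp_sub_natCast]
  · right
    intro r
    simp only [PsiF, if_neg h, vcomp_sub_natCast]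

/-- At a uniform vector every component of `Ψ̂^F` has a strict derivative that is a positive
multiple of the diagonal coordinate plus a smaller perturbation. -/
lemma exists_hasStrictFDerivAt_psiF_apply (N K : ℕ) (hKN : K + 2 ≤ N) (η : ℝ → ℝ) (x p q : ℝ)
    (hp : HasStrictDerivAt η p x) (hq : HasStrictDerivAt η q (2*x)) (hq0 : q ≤ 0)
    (hpq : 0 < p + 8 * q) (i : Fin (2*N+1)) :
    ∃ (l : (Fin (2*N+1) → ℝ) →L[ℝ] ℝ) (D : ℝ) (E : Fin (2*N+1) → ℝ),
      HasStrictFDerivAt (fun r => PsiF N K η r i) l (fun _ => x) ∧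
      (∀ j, l (Pi.single j 1) = (Pi.single j 1 : Fin (2*N+1) → ℝ) i * D + E j) ∧
      ∑ j, |E j| < D := by
  have hproj (k : Fin (2*N+1)) := hasStrictFDerivAt_apply (𝕜 := ℝ) k (fun _ : Fin (2*N+1) => x)
  have hone (k : Fin (2*N+1)) :
      HasStrictFDerivAt (fun r : Fin (2*N+1) → ℝ => η (r k))
        (p • ContinuousLinearMap.proj (R := ℝ) (φ := fun _ : Fin (2*N+1) => ℝ) k) (fun _ => x) :=
    HasStrictDerivAt.comp_hasStrictFDerivAt (f := fun r : Fin (2*N+1) → ℝ => r k) _ hp (hproj k)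
  have hadd (k m : Fin (2*N+1)) :
      HasStrictFDerivAt (fun r : Fin (2*N+1) → ℝ => η (r k + r m))
        (q • (ContinuousLinearMap.proj (R := ℝ) (φ := fun _ : Fin (2*N+1) => ℝ) k +
          ContinuousLinearMap.proj m)) (fun _ => x) := by
    refine HasStrictDerivAt.comp_hasStrictFDerivAt (f := fun r : Fin (2*N+1) → ℝ => r k + r m)
      _ ?_ ((hproj k).add (hproj m))
    simpa [two_mul] using hq
  have htwo (k : Fin (2*N+1)) :
      HasStrictFDerivAt (fun r : Fin (2*N+1) → ℝ => 2 * η (2 * r k))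
        ((2:ℝ) • q • (ContinuousLinearMap.proj (R := ℝ) (φ := fun _ : Fin (2*N+1) => ℝ) k +
          ContinuousLinearMap.proj k)) (fun _ => x) := by
    have hkk := (hadd k k).const_smul (2:ℝ)
    simp only [← two_mul] at hkk
    exact hkk
  rcases psiF_apply_cases N K hKN η i with ⟨a, b, c, d, e, h⟩ | h
  · let s (k j : Fin (2*N+1)) : ℝ := (Pi.single j 1 : Fin (2*N+1) → ℝ) k
    have hs0 (k j) : 0 ≤ s k j := by
      simp only [s, Pi.single_apply]; split_ifs <;> norm_num
    have hs1 (k) : ∑ j, s k j = 1 := by simp [s, Pi.single_apply]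
    have hder := (((((hone i).add (hadd i a)).add (hadd i b)).add (htwo c)).sub
      (hadd c d)).sub (hadd c e)
    refine ⟨_, p + 2 * q, fun j => q * (s a j + s b j + 2 * s c j - s d j - s e j),
      hder.congr_of_eventuallyEq (.of_forall fun r => (h r).symm), ?_, ?_⟩
    · intro j
      simp [s]
      ring
    · calc ∑ j, |q * (s a j + s b j + 2 * s c j - s d j - s e j)|
          ≤ ∑ j, -q * (s a j + s b j + 2 * s c j + s d j + s e j) := by
            refine Finset.sum_le_sum fun j _ => ?_
            rw [abs_mul, abs_of_nonpos hq0]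
            refine mul_le_mul_of_nonneg_left ?_ (by linarith)
            rw [abs_le]
            constructor <;> linarith [hs0 a j, hs0 b j, hs0 c j, hs0 d j, hs0 e j]
        _ = -q * 6 := by
            rw [← Finset.mul_sum]
            simp only [Finset.sum_add_distrib, ← Finset.mul_sum, hs1]
            norm_num
        _ < p + 2 * q := by linarith
  · refine ⟨_, p + 4 * q, fun _ => 0, ((hone i).add (htwo i)).congr_of_eventuallyEq
      (.of_forall fun r => (h r).symm), ?_, ?_⟩
    · intro j
      simp
      ring
    · simp
      linarith

lemma jac_apply_eq_of_hasFDerivAt {N K : ℕ} {η : ℝ → ℝ} {r : Fin (2*N+1) → ℝ}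
    {i : Fin (2*N+1)} {l : (Fin (2*N+1) → ℝ) →L[ℝ] ℝ}
    (h : HasFDerivAt (fun r => PsiF N K η r i) l r) (j : Fin (2*N+1)) :
    Jac N K η r i j = l (Pi.single j 1) := by
  refine HasDerivAt.deriv (HasFDerivAt.comp_hasDerivAt (f := Function.update r j)
    (l := fun r => PsiF N K η r i) (l' := l) _ ?_
    (hasDerivAt_update r j (r j)))
  simpa using h

/-- A diagonal coefficient exceeding the absolute row sum of the perturbation yields strict
diagonal dominance. -/
lemma sdd_of_diagonal_add {m : ℕ} {A : Matrix (Fin m) (Fin m) ℝ} {D : Fin m → ℝ}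
    {E : Fin m → Fin m → ℝ}
    (hA : ∀ i j, A i j = (Pi.single j 1 : Fin m → ℝ) i * D i + E i j)
    (hE : ∀ i, ∑ j, |E i j| < D i) : SDD A := by
  intro i
  have hsum : ∑ j ∈ Finset.univ.erase i, |A i j| = ∑ j ∈ Finset.univ.erase i, |E i j| :=
    Finset.sum_congr rfl fun j hj => by
      rw [hA, Pi.single_eq_of_ne (Finset.ne_of_mem_erase hj).symm, zero_mul, zero_add]
  have hdiag : A i i = D i + E i i := by simp [hA]
  have hlt : ∑ j ∈ Finset.univ.erase i, |A i j| < A i i := by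
    have := Finset.sum_erase_add Finset.univ (fun j => |E i j|) (Finset.mem_univ i)
    rw [hsum, hdiag]
    linarith [hE i, neg_abs_le (E i i)]
  exact ⟨(Finset.sum_nonneg fun _ _ => abs_nonneg _).trans_lt hlt, hlt⟩

lemma SDD.det_ne_zero {m : ℕ} {A : Matrix (Fin m) (Fin m) ℝ} (hA : SDD A) : A.det ≠ 0 :=
  det_ne_zero_of_sum_row_lt_diag fun i => by
    simpa only [Real.norm_eq_abs, abs_of_pos (hA i).1] using (hA i).2

/-- A continuous function that is negative to the left and positive to the right of a point
vanishes there. -/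
lemma eq_zero_of_neg_left_of_pos_right {f : ℝ → ℝ} {a : ℝ} (ha : 0 < a) (hf : ContinuousAt f a)
    (hneg : ∀ x ∈ Ioo 0 a, f x < 0) (hpos : ∀ x ∈ Ioi a, 0 < f x) : f a = 0 := by
  apply le_antisymm
  · refine le_of_tendsto (hf.tendsto.mono_left (nhdsWithin_le_nhds (s := Iio a))) ?_
    filter_upwards [Ioo_mem_nhdsLT ha] with x hx using (hneg x hx).le
  · refine ge_of_tendsto (hf.tendsto.mono_left (nhdsWithin_le_nhds (s := Ioi a))) ?_
    filter_upwards [self_mem_nhdsWithin] with x hx using (hpos x hx).le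

/-- A map between finite-dimensional real spaces whose strict derivative has an invertible matrix
restricts to a bijection between open neighborhoods. -/
lemma exists_bijOn_of_hasStrictFDerivAt {m : ℕ} {f : (Fin m → ℝ) → Fin m → ℝ} {x : Fin m → ℝ}
    {L : (Fin m → ℝ) →L[ℝ] Fin m → ℝ} (hf : HasStrictFDerivAt f L x)
    (hL : (LinearMap.toMatrix' (L : (Fin m → ℝ) →ₗ[ℝ] Fin m → ℝ)).det ≠ 0) :
    ∃ U V : Set (Fin m → ℝ), IsOpen U ∧ IsOpen V ∧ x ∈ U ∧ f x ∈ V ∧ Set.BijOn f U V := by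
  have hdet : L.det ≠ 0 := by
    simpa [ContinuousLinearMap.det, LinearMap.det_toMatrix'] using hL
  have hf' : HasStrictFDerivAt f
      (L.toContinuousLinearEquivOfDetNeZero hdet : (Fin m → ℝ) →L[ℝ] Fin m → ℝ) x := by
    simpa using hf
  exact ⟨_, _, (hf'.toOpenPartialHomeomorph f).open_source,
    (hf'.toOpenPartialHomeomorph f).open_target, hf'.mem_toOpenPartialHomeomorph_source,
    hf'.image_mem_toOpenPartialHomeomorph_target, (hf'.toOpenPartialHomeomorph f).bijOn⟩

/-- If `η'(a₀) + 8η'(2a₀) > 0` then `DΨ̂^F(a₀)` is strictly diagonally dominant with positive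
diagonal, hence invertible, and `Ψ̂^F` is a bijection between neighborhoods of `a₀` and of
`0 = Ψ̂^F(a₀)`. -/
theorem jacobian_sdd_and_local_bijection
    (N K : ℕ) (hK : 2 ≤ K) (hKN : K + 2 ≤ N)
    (φ η : ℝ → ℝ) (hφ : ContDiffOn ℝ 3 φ (Set.Ioi 0)) (hη : η = deriv φ)
    (r1 r2 a0 a1 : ℝ) (hA : Assump η r1 r2 a0 a1)
    (hdd : 0 < deriv η a0 + 8 * deriv η (2*a0)) :
    SDD (Jac N K η (fun _ => a0)) ∧
    (Jac N K η (fun _ => a0)).det ≠ 0 ∧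
    PsiF N K η (fun _ => a0) = 0 ∧
    ∃ U V : Set (Fin (2*N+1) → ℝ), IsOpen U ∧ IsOpen V ∧
      (fun _ => a0) ∈ U ∧ (0 : Fin (2*N+1) → ℝ) ∈ V ∧
      Set.BijOn (PsiF N K η) U V := by
  obtain ⟨ha0, har1, hr12, hr2, -, -, hη'neg, -, -, hneg, hpos, -, -⟩ := hA
  have hdiff (x : ℝ) (hx : 0 < x) : HasStrictDerivAt η (deriv η x) x := by
    have hcd : ContDiffOn ℝ 2 η (Set.Ioi 0) := by
      rw [hη]
      exact hφ.deriv_of_isOpen isOpen_Ioi (by norm_num)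
    exact (hcd.contDiffAt (Ioi_mem_nhds hx)).hasStrictDerivAt (by norm_num)
  have hp := hdiff a0 ha0
  have hq := hdiff (2*a0) (by linarith)
  choose l D E hl hlE hED using exists_hasStrictFDerivAt_psiF_apply N K hKN η a0 _ _ hp hq
    (hη'neg (2*a0) (show r1 < 2*a0 by linarith)).le hdd
  have hJ (i j) : Jac N K η (fun _ => a0) i j = l i (Pi.single j 1) :=
    jac_apply_eq_of_hasFDerivAt (hl i).hasFDerivAt j
  have hsdd : SDD (Jac N K η (fun _ => a0)) :=
    sdd_of_diagonal_add (fun i j => (hJ i j).trans (hlE i j)) hED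
  have hzero : η a0 + 2 * η (2*a0) = 0 := by
    refine eq_zero_of_neg_left_of_pos_right (f := etaHat η) ha0 ?_ hneg hpos
    exact hp.hasDerivAt.continuousAt.add (continuousAt_const.mul
      (ContinuousAt.comp (f := fun r : ℝ => 2 * r) hq.hasDerivAt.continuousAt (by fun_prop)))
  have hPsi : PsiF N K η (fun _ => a0) = 0 := by
    funext i
    rcases psiF_apply_cases N K hKN η i with ⟨a, b, c, d, e, h⟩ | h
    · rw [h, ← two_mul a0, Pi.zero_apply]
      linarith
    · rw [h, Pi.zero_apply, hzero]
  refine ⟨hsdd, hsdd.det_ne_zero, hPsi, ?_⟩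
  rw [← hPsi]
  refine exists_bijOn_of_hasStrictFDerivAt (hasStrictFDerivAt_pi.2 hl) ?_
  convert hsdd.det_ne_zero using 2
  ext i j
  rw [hJ, LinearMap.toMatrix'_apply]
  simp
end
end

section
/- Let r_L and r_U satisfy 0 < r_L < r_U < a₁ and set Ω = (r_L, r_U)^{2N+1}. Let Φ ∈ ℝ^{2N+1}, define the local map Ψ̂^L by ψ̂^L_i(r) = η̂(r_i) for −N ≤ i ≤ N, and define the homotopy h(r,t) = (1−t)(Ψ̂^L(r) − Φ) + t(Ψ̂^F(r) − Φ). Suppose that for every t ∈ [0,1], every index i, and every r in the closed cube [r_L, r_U]^{2N+1}: h_i(r,t) > 0 whenever r_i = r_U, and h_i(r,t) < 0 whenever r_i = r_L. If in addition the Jacobian DΨ̂^F(r) is strictly diagonally dominant with positive diagonal entries for every r ∈ Ω, then the equation Ψ̂^F(r) = Φ has exactly one solution in Ω. -/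
open Finset Set

noncomputable section

section FixedPoint

variable {X : Type*} [MetricSpace X]

/-- A continuous self-map of a nonempty compact set whose image lies in a region where the map
strictly decreases distances has a fixed point. -/
theorem exists_fixedPoint_of_dist_lt {T : X → X} {C O : Set X} (hC : IsCompact C)
    (hne : C.Nonempty) (hcont : ContinuousOn T C) (hmap : MapsTo T C O) (hOC : O ⊆ C)
    (hlt : ∀ x ∈ O, ∀ y ∈ O, x ≠ y → dist (T x) (T y) < dist x y) :
    ∃ x ∈ O, T x = x := by
  have hsub : T '' C ⊆ C := (hmap.mono_right hOC).image_subset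
  obtain ⟨x, hx, hmin⟩ := (hC.image_of_continuousOn hcont).exists_isMinOn (hne.image T)
    (f := fun x => dist x (T x))
    (continuous_dist.comp_continuousOn (continuousOn_id.prodMk (hcont.mono hsub)))
  have hxO : x ∈ O := hmap.image_subset hx
  refine ⟨x, hxO, ?_⟩
  by_contra hfix
  have hTx : T x ∈ T '' C := ⟨x, hsub hx, rfl⟩
  exact absurd (hmin hTx)
    (not_le.mpr (hlt x hxO (T x) (hmap.image_subset hTx) (Ne.symm hfix)))

end FixedPoint

section Cube

variable {m : ℕ}

/-- Derivative along a coordinate direction, expressed through the Fréchet derivative. -/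
theorem deriv_update_eq_fderiv_single {f : (Fin m → ℝ) → ℝ} {r : Fin m → ℝ}
    (hf : DifferentiableAt ℝ f r) (j : Fin m) :
    deriv (fun t => f (Function.update r j t)) (r j) = fderiv ℝ f r (Pi.single j 1) := by
  have hu := hasDerivAt_update r j (r j)
  have hf' : HasFDerivAt f (fderiv ℝ f r) (Function.update r j (r j)) := by
    rw [Function.update_eq_self]
    exact hf.hasFDerivAt
  exact (hf'.comp_hasDerivAt (r j) hu).deriv

/-- For a row `a` dominated by its positive diagonal entry and a small enough step `ε`, the
functional `v ↦ v i - ε * (a ⬝ v)` strictly decreases the sup norm. -/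
theorem abs_sub_mul_sum_lt {a v : Fin m → ℝ} {i : Fin m} {ε : ℝ} (hε : 0 < ε)
    (hεa : ε * a i ≤ 1) (ha : ∑ j ∈ Finset.univ.erase i, |a j| < a i) (hv : v ≠ 0) :
    |v i - ε * ∑ j, v j * a j| < ‖v‖ := by
  have hv0 : 0 < ‖v‖ := norm_pos_iff.mpr hv
  have hvj : ∀ j, |v j| ≤ ‖v‖ := fun j => norm_le_pi_norm v j
  rw [← Finset.add_sum_erase _ _ (Finset.mem_univ i)]
  have hoff : |∑ j ∈ Finset.univ.erase i, v j * a j|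
      ≤ ‖v‖ * ∑ j ∈ Finset.univ.erase i, |a j| := by
    rw [Finset.mul_sum]
    refine (Finset.abs_sum_le_sum_abs _ _).trans (Finset.sum_le_sum fun j _ => ?_)
    rw [abs_mul]
    exact mul_le_mul_of_nonneg_right (hvj j) (abs_nonneg _)
  have hoff' : |∑ j ∈ Finset.univ.erase i, v j * a j| < ‖v‖ * a i :=
    hoff.trans_lt (mul_lt_mul_of_pos_left ha hv0)
  calc |v i - ε * (v i * a i + ∑ j ∈ Finset.univ.erase i, v j * a j)|
      = |(1 - ε * a i) * v i - ε * ∑ j ∈ Finset.univ.erase i, v j * a j| := by ring_nf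
    _ ≤ |(1 - ε * a i) * v i| + |ε * ∑ j ∈ Finset.univ.erase i, v j * a j| := abs_sub _ _
    _ = (1 - ε * a i) * |v i| + ε * |∑ j ∈ Finset.univ.erase i, v j * a j| := by
        rw [abs_mul, abs_mul, abs_of_nonneg (sub_nonneg.mpr hεa), abs_of_pos hε]
    _ < (1 - ε * a i) * ‖v‖ + ε * (‖v‖ * a i) :=
        add_lt_add_of_le_of_lt (mul_le_mul_of_nonneg_left (hvj i) (sub_nonneg.mpr hεa))
          (mul_lt_mul_of_pos_left hoff' hε)
    _ = ‖v‖ := by ring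

/-- A `C¹` map on a neighbourhood of a closed cube that points outwards on the faces and whose
Jacobian is strictly diagonally dominant with positive diagonal on the open cube has exactly one
zero in the open cube. -/
theorem existsUnique_zero_of_sdd {F : (Fin m → ℝ) → Fin m → ℝ} {U : Set (Fin m → ℝ)}
    (hUo : IsOpen U) {l u : ℝ} (hlu : l < u)
    (hcU : ∀ r : Fin m → ℝ, (∀ k, r k ∈ Icc l u) → r ∈ U) (hF : ContDiffOn ℝ 1 F U)
    (hpos : ∀ r : Fin m → ℝ, (∀ k, r k ∈ Icc l u) → ∀ i, r i = u → 0 < F r i)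
    (hneg : ∀ r : Fin m → ℝ, (∀ k, r k ∈ Icc l u) → ∀ i, r i = l → F r i < 0)
    (hsdd : ∀ r : Fin m → ℝ, (∀ k, r k ∈ Ioo l u) →
      SDD (fun i j => deriv (fun t => F (Function.update r j t) i) (r j))) :
    ∃! r : Fin m → ℝ, (∀ k, r k ∈ Ioo l u) ∧ F r = 0 := by
  set C : Set (Fin m → ℝ) := Set.univ.pi fun _ => Icc l u
  set O : Set (Fin m → ℝ) := Set.univ.pi fun _ => Ioo l u
  have hmemC : ∀ r, r ∈ C ↔ ∀ k, r k ∈ Icc l u := fun r => Set.mem_univ_pi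
  have hmemO : ∀ r, r ∈ O ↔ ∀ k, r k ∈ Ioo l u := fun r => Set.mem_univ_pi
  have hOC : O ⊆ C := fun r hr => (hmemC r).2 fun k => Ioo_subset_Icc_self ((hmemO r).1 hr k)
  have hCU : C ⊆ U := fun r hr => hcU r ((hmemC r).1 hr)
  have hCc : IsCompact C := isCompact_univ_pi fun _ => isCompact_Icc
  have hCconv : Convex ℝ C := convex_pi fun _ _ => convex_Icc l u
  have hOconv : Convex ℝ O := convex_pi fun _ _ => convex_Ioo l u
  have hdiff : ∀ r ∈ C, DifferentiableAt ℝ F r := fun r hr =>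
    (hF.differentiableOn one_ne_zero).differentiableAt (hUo.mem_nhds (hCU hr))
  have hdiffi : ∀ i, ∀ r ∈ C, DifferentiableAt ℝ (fun r => F r i) r := fun i r hr =>
    differentiableAt_pi.mp (hdiff r hr) i
  obtain ⟨M, hM⟩ := hCc.exists_bound_of_continuousOn
    ((hF.continuousOn_fderiv_of_isOpen hUo le_rfl).mono hCU)
  have hM0 : 0 ≤ M := by
    have hlC : (fun _ => l) ∈ C := (hmemC _).2 fun _ => ⟨le_rfl, hlu.le⟩
    exact (norm_nonneg _).trans (hM _ hlC)
  have hlip : ∀ x ∈ C, ∀ y ∈ C, ‖F y - F x‖ ≤ M * ‖y - x‖ := fun x hx y hy =>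
    hCconv.norm_image_sub_le_of_norm_fderiv_le hdiff hM hx hy
  have hface : ∀ r ∈ C, ∀ i, ∀ s ∈ Icc l u, ∀ k, Function.update r i s k ∈ Icc l u := by
    intro r hr i s hs k
    rcases eq_or_ne k i with rfl | hk
    · simpa using hs
    · simpa [hk] using (hmemC r).1 hr k
  have hlipi : ∀ r ∈ C, ∀ i, ∀ s ∈ Icc l u,
      |F (Function.update r i s) i - F r i| ≤ M * |s - r i| := by
    intro r hr i s hs
    have hnorm : ‖Function.update r i s - r‖ ≤ |s - r i| := by
      refine (pi_norm_le_iff_of_nonneg (abs_nonneg _)).2 fun k => ?_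
      rcases eq_or_ne k i with rfl | hk
      · simp
      · simp [hk]
    exact (norm_le_pi_norm (F (Function.update r i s) - F r) i).trans
      ((hlip r hr _ ((hmemC _).2 (hface r hr i s hs))).trans (mul_le_mul_of_nonneg_left hnorm hM0))
  obtain ⟨ε, hε, hεM⟩ : ∃ ε : ℝ, 0 < ε ∧ ε * M ≤ 1 := by
    refine ⟨1 / (M + 1), by positivity, ?_⟩
    rw [one_div_mul_eq_div, div_le_one (by positivity)]
    linarith
  let T : (Fin m → ℝ) → Fin m → ℝ := fun r => r - ε • F r
  have hTcont : ContinuousOn T C :=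
    continuousOn_id.sub ((hF.continuousOn.mono hCU).const_smul ε)
  have hTmaps : MapsTo T C O := by
    intro r hr
    refine (hmemO _).2 fun i => ?_
    have hri := (hmemC r).1 hr i
    have hstep : ∀ d : ℝ, 0 ≤ d → ε * (M * d) ≤ d := fun d hd => by nlinarith
    have hl : l ∈ Icc l u := ⟨le_rfl, hlu.le⟩
    have hu : u ∈ Icc l u := ⟨hlu.le, le_rfl⟩
    have hFu := hpos _ (hface r hr i u hu) i (by simp)
    have hFl := hneg _ (hface r hr i l hl) i (by simp)
    have hLu := hlipi r hr i u hu
    have hLl := hlipi r hr i l hl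
    rw [abs_of_nonneg (sub_nonneg.mpr hri.2)] at hLu
    rw [abs_sub_comm l, abs_of_nonneg (sub_nonneg.mpr hri.1)] at hLl
    have hsu := hstep _ (sub_nonneg.mpr hri.2)
    have hsl := hstep _ (sub_nonneg.mpr hri.1)
    have hlow : -(M * (u - r i)) < F r i := by
      linarith [le_abs_self (F (Function.update r i u) i - F r i)]
    have hupp : F r i < M * (r i - l) := by
      linarith [neg_abs_le (F (Function.update r i l) i - F r i)]
    have h1 := mul_lt_mul_of_pos_left hlow hε
    have h2 := mul_lt_mul_of_pos_left hupp hε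
    change l < r i - ε * F r i ∧ r i - ε * F r i < u
    constructor <;> linarith
  have hTlt : ∀ x ∈ O, ∀ y ∈ O, x ≠ y → dist (T x) (T y) < dist x y := by
    intro x hx y hy hxy
    rw [dist_eq_norm, dist_eq_norm]
    have hv : x - y ≠ 0 := sub_ne_zero.mpr hxy
    refine (pi_norm_lt_iff (norm_pos_iff.mpr hv)).2 fun i => ?_
    obtain ⟨z, hz, hmv⟩ := domain_mvt (f := fun r => F r i)
      (f' := fun r => fderiv ℝ (fun r => F r i) r) (s := O)
      (fun r hr => (hdiffi i r (hOC hr)).hasFDerivAt.hasFDerivWithinAt) hOconv hy hx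
    have hzO : z ∈ O := hOconv.segment_subset hy hx hz
    have hzC := hOC hzO
    have hpart : ∀ j, deriv (fun t => F (Function.update z j t) i) (z j) =
        fderiv ℝ (fun r => F r i) z (Pi.single j 1) := fun j =>
      deriv_update_eq_fderiv_single (hdiffi i z hzC) j
    have hrow := (hsdd z ((hmemO z).1 hzO) i).2
    simp only [hpart] at hrow
    have hdiag : fderiv ℝ (fun r => F r i) z (Pi.single i 1) ≤ M := by
      have hcomp : fderiv ℝ (fun r => F r i) z (Pi.single i 1) =
          fderiv ℝ F z (Pi.single i 1) i := by
        rw [((hasFDerivAt_pi'.1 (hdiff z hzC).hasFDerivAt) i).fderiv]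
        rfl
      rw [hcomp]
      calc fderiv ℝ F z (Pi.single i 1) i ≤ ‖fderiv ℝ F z (Pi.single i 1) i‖ := le_abs_self _
        _ ≤ ‖fderiv ℝ F z (Pi.single i 1)‖ := norm_le_pi_norm _ i
        _ ≤ ‖fderiv ℝ F z‖ * ‖(Pi.single i 1 : Fin m → ℝ)‖ := ContinuousLinearMap.le_opNorm _ _
        _ ≤ M := by rw [Pi.norm_single, norm_one, mul_one]; exact hM z hzC
    have hsum : F x i - F y i =
        ∑ j, (x - y) j * fderiv ℝ (fun r => F r i) z (Pi.single j 1) := by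
      rw [hmv]
      conv_lhs => rw [pi_eq_sum_univ' (x - y)]
      simp [map_sum, map_smul]
    have key := abs_sub_mul_sum_lt (v := x - y)
      (a := fun j => fderiv ℝ (fun r => F r i) z (Pi.single j 1)) hε
      ((mul_le_mul_of_nonneg_left hdiag hε.le).trans hεM) hrow hv
    rw [← hsum] at key
    have hT : (T x - T y) i = (x - y) i - ε * (F x i - F y i) := by
      simp only [T, Pi.sub_apply, Pi.smul_apply, smul_eq_mul]
      ring
    rwa [hT, Real.norm_eq_abs]
  have hfix : ∀ r, T r = r ↔ F r = 0 := fun r => by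
    simp [T, hε.ne']
  have hCne : C.Nonempty := ⟨fun _ => l, (hmemC _).2 fun _ => ⟨le_rfl, hlu.le⟩⟩
  obtain ⟨x, hxO, hx⟩ := exists_fixedPoint_of_dist_lt hCc hCne hTcont hTmaps hOC hTlt
  refine ⟨x, ⟨(hmemO x).1 hxO, (hfix x).1 hx⟩, fun y ⟨hyO, hy⟩ => ?_⟩
  by_contra hne
  have hlt := hTlt y ((hmemO y).2 hyO) x hxO hne
  rw [(hfix y).2 hy, hx] at hlt
  exact lt_irrefl _ hlt

end Cube

theorem vcomp_eq_apply {N : ℕ} {j : ℤ} (hl : -(N : ℤ) ≤ j) (hu : j ≤ N) :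
    ∃ k : Fin (2 * N + 1), ∀ r : Fin (2 * N + 1) → ℝ, vcomp N r j = r k := by
  have h : (j + N).toNat < 2 * N + 1 := by omega
  exact ⟨⟨_, h⟩, fun r => by simp [vcomp, h]⟩

/-- `Ψ̂^F` is `C¹` on the open positive orthant. -/
theorem contDiffOn_PsiF {N K : ℕ} (hKN : K + 2 ≤ N) {η : ℝ → ℝ}
    (hη : ContDiffOn ℝ 1 η (Ioi 0)) :
    ContDiffOn ℝ 1 (PsiF N K η) {r | ∀ k, 0 < r k} := by
  have hcoord : ∀ k : Fin (2 * N + 1),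
      ContDiffOn ℝ 1 (fun r : Fin (2 * N + 1) → ℝ => r k) {r | ∀ k, 0 < r k} :=
    fun k => (contDiff_apply ℝ ℝ k).contDiffOn
  have hone : ∀ k : Fin (2 * N + 1),
      ContDiffOn ℝ 1 (fun r : Fin (2 * N + 1) → ℝ => η (r k)) {r | ∀ k, 0 < r k} :=
    fun k => hη.comp (hcoord k) fun r hr => hr k
  have htwo : ∀ k : Fin (2 * N + 1),
      ContDiffOn ℝ 1 (fun r : Fin (2 * N + 1) → ℝ => 2 * η (2 * r k)) {r | ∀ k, 0 < r k} :=
    fun k => contDiffOn_const.mul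
      (hη.comp (contDiffOn_const.mul (hcoord k)) fun r hr => mul_pos two_pos (hr k))
  have hadd : ∀ k k' : Fin (2 * N + 1),
      ContDiffOn ℝ 1 (fun r : Fin (2 * N + 1) → ℝ => η (r k + r k')) {r | ∀ k, 0 < r k} :=
    fun k k' => hη.comp ((hcoord k).add (hcoord k')) fun r hr => add_pos (hr k) (hr k')
  refine contDiffOn_pi.2 fun i => ?_
  have hi := i.isLt
  obtain ⟨k, hk⟩ := vcomp_eq_apply (N := N) (j := (i.val : ℤ) - N) (by omega) (by omega)
  by_cases hj : -(K : ℤ) + 1 ≤ (i.val : ℤ) - N ∧ (i.val : ℤ) - N ≤ (K : ℤ) - 1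
  · obtain ⟨p, hp⟩ := vcomp_eq_apply (N := N) (j := (i.val : ℤ) - N - 1) (by omega) (by omega)
    obtain ⟨q, hq⟩ := vcomp_eq_apply (N := N) (j := (i.val : ℤ) - N + 1) (by omega) (by omega)
    obtain ⟨c, hc⟩ := vcomp_eq_apply (N := N) (j := (K : ℤ)) (by omega) (by omega)
    obtain ⟨d, hd⟩ := vcomp_eq_apply (N := N) (j := (K : ℤ) - 1) (by omega) (by omega)
    obtain ⟨e, he⟩ := vcomp_eq_apply (N := N) (j := (K : ℤ) + 1) (by omega) (by omega)
    simp only [PsiF, if_pos hj, hk, hp, hq, hc, hd, he]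
    exact (((((hone k).add (hadd k p)).add (hadd k q)).add (htwo c)).sub (hadd c d)).sub (hadd c e)
  · simp only [PsiF, if_neg hj, hk]
    exact (hone k).add (htwo k)

/-- Lemma: if the homotopy between the local and force-based conjugate-force systems is
positive (resp. negative) on the faces `r_i = r_U` (resp. `r_i = r_L`) of the cube, and
`DΨ̂^F` is strictly diagonally dominant on the open cube, then `Ψ̂^F(r) = Φ` has exactly one
solution in the open cube. -/
theorem psiF_unique_solution_of_homotopy
    (N K : ℕ) (hK : 2 ≤ K) (hKN : K + 2 ≤ N)
    (φ η : ℝ → ℝ) (hφ : ContDiffOn ℝ 3 φ (Set.Ioi 0)) (hη : η = deriv φ)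
    (r1 r2 a0 a1 : ℝ) (hA : Assump η r1 r2 a0 a1)
    (rL rU : ℝ) (hL : 0 < rL) (hLU : rL < rU) (hU : rU < a1)
    (Φ : Fin (2*N+1) → ℝ)
    (hpos : ∀ t ∈ Icc (0:ℝ) 1, ∀ r : Fin (2*N+1) → ℝ, (∀ k, r k ∈ Icc rL rU) →
      ∀ i, r i = rU →
        0 < (1-t) * (etaHat η (r i) - Φ i) + t * (PsiF N K η r i - Φ i))
    (hneg : ∀ t ∈ Icc (0:ℝ) 1, ∀ r : Fin (2*N+1) → ℝ, (∀ k, r k ∈ Icc rL rU) →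
      ∀ i, r i = rL →
        (1-t) * (etaHat η (r i) - Φ i) + t * (PsiF N K η r i - Φ i) < 0)
    (hSDD : ∀ r : Fin (2*N+1) → ℝ, (∀ k, r k ∈ Ioo rL rU) → SDD (Jac N K η r)) :
    ∃! r : Fin (2*N+1) → ℝ, (∀ k, r k ∈ Ioo rL rU) ∧ PsiF N K η r = Φ := by
  have hη1 : ContDiffOn ℝ 1 η (Ioi 0) := by
    rw [hη]
    exact hφ.deriv_of_isOpen isOpen_Ioi (show (1 : WithTop ℕ∞) + 1 ≤ 3 by norm_num)
  have hopen : IsOpen {r : Fin (2 * N + 1) → ℝ | ∀ k, 0 < r k} := by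
    simp only [Set.ofPred_forall]
    exact isOpen_iInter_of_finite fun k => isOpen_lt continuous_const (continuous_apply k)
  have hone : (1 : ℝ) ∈ Icc (0 : ℝ) 1 := ⟨zero_le_one, le_rfl⟩
  have h := existsUnique_zero_of_sdd (F := fun r => PsiF N K η r - Φ) hopen hLU
    (fun r hr k => hL.trans_le (hr k).1) ((contDiffOn_PsiF hKN hη1).sub contDiffOn_const)
    (fun r hr i hi => by simpa using hpos 1 hone r hr i hi)
    (fun r hr i hi => by simpa using hneg 1 hone r hr i hi)
    (fun r hr => by simpa [Jac, SDD] using hSDD r hr)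
  simpa only [sub_eq_zero] using h
end
end

section
/- Suppose r_L and r_U satisfy r̃₂/2 < r_L < r_U and η′(r_U) + 12η′(2r_L) ≥ 0. Then r_U < a₁, and the Jacobian matrix DΨ̂^F(r) is strictly diagonally dominant with positive diagonal entries for every r in Ω = (r_L, r_U)^{2N+1}. -/
open Finset Set

noncomputable section

/-- On an admissible component index, `vcomp` reads off the corresponding entry. -/
lemma vcomp_eq {N : ℕ} (r : Fin (2*N+1) → ℝ) (a : Fin (2*N+1)) {j : ℤ}
    (h : j + N = (a.val : ℤ)) : vcomp N r j = r a := by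
  have ha := a.isLt
  have hv : (j + N).toNat = a.val := by omega
  unfold vcomp
  rw [dif_pos (by omega)]
  congr 1
  exact Fin.ext hv

/-- A row of the form `d • e i + B` is strictly dominated by its diagonal entry as soon as the
`ℓ¹` norm of `B` is smaller than `d`. -/
lemma row_dominant_of_sum_abs_lt {ι : Type*} [Fintype ι] [DecidableEq ι] {A B : ι → ℝ} {d : ℝ}
    {i : ι} (hA : ∀ k, A k = d * (Pi.single k (1:ℝ) : ι → ℝ) i + B k) (hB : ∑ k, |B k| < d) :
    0 < A i ∧ ∑ k ∈ Finset.univ.erase i, |A k| < A i := by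
  have hsum : ∑ k ∈ Finset.univ.erase i, |A k| = ∑ k ∈ Finset.univ.erase i, |B k| := by
    refine Finset.sum_congr rfl fun k hk => ?_
    rw [hA k, Pi.single_eq_of_ne (Finset.ne_of_mem_erase hk).symm]
    simp
  have hii : A i = d + B i := by simp [hA i]
  have hsplit := Finset.add_sum_erase Finset.univ (fun k => |B k|) (Finset.mem_univ i)
  have hlt : ∑ k ∈ Finset.univ.erase i, |A k| < A i := by
    rw [hsum, hii]
    have := neg_abs_le (B i)
    linarith
  exact ⟨(Finset.sum_nonneg fun k _ => abs_nonneg (A k)).trans_lt hlt, hlt⟩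

lemma hasDerivAt_update_apply {ι : Type*} [Fintype ι] [DecidableEq ι] (r : ι → ℝ) (k a : ι) :
    HasDerivAt (fun t => Function.update r k t a) ((Pi.single k (1:ℝ) : ι → ℝ) a) (r k) :=
  hasDerivAt_pi.1 (hasDerivAt_update r k (r k)) a

/-- Chain rule for a pair interaction `η (r a + r b)` along the `k`-th coordinate. -/
lemma hasDerivAt_pair {ι : Type*} [Fintype ι] [DecidableEq ι] {η : ℝ → ℝ} (r : ι → ℝ) (k a b : ι)
    (h : DifferentiableAt ℝ η (r a + r b)) :
    HasDerivAt (fun t => η (Function.update r k t a + Function.update r k t b))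
      (deriv η (r a + r b) * ((Pi.single k (1:ℝ) : ι → ℝ) a + (Pi.single k (1:ℝ) : ι → ℝ) b))
      (r k) := by
  have hin := (hasDerivAt_update_apply r k a).fun_add (hasDerivAt_update_apply r k b)
  exact HasDerivAt.comp (h₂ := η) (r k) (by simpa using h.hasDerivAt) hin

/-- Chain rule for a nearest-neighbour interaction `η (r a)` along the `k`-th coordinate. -/
lemma hasDerivAt_comp_update {ι : Type*} [Fintype ι] [DecidableEq ι] {η : ℝ → ℝ} (r : ι → ℝ) (k a : ι)
    (h : DifferentiableAt ℝ η (r a)) :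
    HasDerivAt (fun t => η (Function.update r k t a))
      (deriv η (r a) * (Pi.single k (1:ℝ) : ι → ℝ) a) (r k) :=
  HasDerivAt.comp (h₂ := η) (r k) (by simpa using h.hasDerivAt) (hasDerivAt_update_apply r k a)

/-- Summing a weighted pair of coordinate indicators over all coordinates. -/
lemma sum_abs_mul_single_add {ι : Type*} [Fintype ι] [DecidableEq ι] (x : ℝ) (a b : ι) :
    ∑ k, |x * ((Pi.single k (1:ℝ) : ι → ℝ) a + (Pi.single k (1:ℝ) : ι → ℝ) b)| = 2 * |x| := by
  have h : ∀ k, |x * ((Pi.single k (1:ℝ) : ι → ℝ) a + (Pi.single k (1:ℝ) : ι → ℝ) b)| =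
      |x| * (Pi.single k (1:ℝ) : ι → ℝ) a + |x| * (Pi.single k (1:ℝ) : ι → ℝ) b := by
    intro k
    have hnn : ∀ c, 0 ≤ (Pi.single k (1:ℝ) : ι → ℝ) c := fun c => by
      rw [Pi.single_apply]; split_ifs <;> norm_num
    rw [abs_mul, abs_of_nonneg (add_nonneg (hnn a) (hnn b)), mul_add]
  rw [Finset.sum_congr rfl fun k _ => h k, Finset.sum_add_distrib, ← Finset.mul_sum,
    ← Finset.mul_sum]
  simp only [Pi.single_apply, Finset.sum_ite_eq, Finset.mem_univ, if_true]
  ring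

/-- Every row of the Jacobian is strictly dominated by its diagonal if all second-neighbour
stiffnesses are at most `m` in modulus while all first-neighbour stiffnesses exceed `12 * m`. -/
lemma sdd_jac_of_stiffness_bounds {N K : ℕ} (hKN : K + 2 ≤ N) {η : ℝ → ℝ}
    {r : Fin (2*N+1) → ℝ} {m : ℝ}
    (hd1 : ∀ a, DifferentiableAt ℝ η (r a)) (hd2 : ∀ a b, DifferentiableAt ℝ η (r a + r b))
    (hm1 : ∀ a, 12 * m < deriv η (r a)) (hm2 : ∀ a b, |deriv η (r a + r b)| ≤ m) :
    SDD (Jac N K η r) := by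
  have hm0 : 0 ≤ m := (abs_nonneg _).trans (hm2 0 0)
  intro i
  have hi := i.isLt
  by_cases hc : -(K:ℤ)+1 ≤ (i.val : ℤ) - N ∧ (i.val : ℤ) - N ≤ (K:ℤ)-1
  · obtain ⟨p, hp⟩ : ∃ p : Fin (2*N+1), (i.val : ℤ) - N - 1 + N = (p.val : ℤ) :=
      ⟨⟨i.val - 1, by omega⟩, by simp only; omega⟩
    obtain ⟨q, hq⟩ : ∃ q : Fin (2*N+1), (i.val : ℤ) - N + 1 + N = (q.val : ℤ) :=
      ⟨⟨i.val + 1, by omega⟩, by simp only; omega⟩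
    obtain ⟨κ, hκ⟩ : ∃ a : Fin (2*N+1), (K:ℤ) + N = (a.val : ℤ) :=
      ⟨⟨K + N, by omega⟩, by simp⟩
    obtain ⟨u, hu⟩ : ∃ a : Fin (2*N+1), (K:ℤ) - 1 + N = (a.val : ℤ) :=
      ⟨⟨K + N - 1, by omega⟩, by simp only; omega⟩
    obtain ⟨v, hv⟩ : ∃ a : Fin (2*N+1), (K:ℤ) + 1 + N = (a.val : ℤ) :=
      ⟨⟨K + N + 1, by omega⟩, by simp only; omega⟩
    have hPsi : ∀ s : Fin (2*N+1) → ℝ, PsiF N K η s i =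
        η (s i) + η (s i + s p) + η (s i + s q) + 2 * η (s κ + s κ)
          - η (s κ + s u) - η (s κ + s v) := by
      intro s
      simp only [PsiF]
      rw [if_pos hc, vcomp_eq s i (by ring), vcomp_eq s p hp, vcomp_eq s q hq, vcomp_eq s κ hκ,
        vcomp_eq s u hu, vcomp_eq s v hv, two_mul (s κ)]
    let T : Fin (2*N+1) → Fin (2*N+1) → Fin (2*N+1) → ℝ := fun a b k =>
      deriv η (r a + r b) *
        ((Pi.single k (1:ℝ) : Fin (2*N+1) → ℝ) a + (Pi.single k (1:ℝ) : Fin (2*N+1) → ℝ) b)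
    have hT : ∀ a b, ∑ k, |T a b k| ≤ 2 * m := fun a b => by
      rw [sum_abs_mul_single_add]
      linarith [hm2 a b]
    refine row_dominant_of_sum_abs_lt (d := deriv η (r i))
      (B := fun k => T i p k + T i q k + 2 * T κ κ k - T κ u k - T κ v k) (fun k => ?_) ?_
    · simp only [Jac, hPsi]
      rw [((((((hasDerivAt_comp_update r k i (hd1 i)).fun_add
        (hasDerivAt_pair r k i p (hd2 _ _))).fun_add
        (hasDerivAt_pair r k i q (hd2 _ _))).fun_add
        ((hasDerivAt_pair r k κ κ (hd2 _ _)).const_mul 2)).fun_sub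
        (hasDerivAt_pair r k κ u (hd2 _ _))).fun_sub
        (hasDerivAt_pair r k κ v (hd2 _ _))).deriv]
      simp only [T]
      ring
    · have hle : ∀ k, |T i p k + T i q k + 2 * T κ κ k - T κ u k - T κ v k| ≤
          |T i p k| + |T i q k| + 2 * |T κ κ k| + |T κ u k| + |T κ v k| := by
        intro k
        rw [abs_le]
        constructor <;>
        linarith [neg_abs_le (T i p k), neg_abs_le (T i q k), neg_abs_le (T κ κ k),
          neg_abs_le (T κ u k), neg_abs_le (T κ v k), le_abs_self (T i p k),
          le_abs_self (T i q k), le_abs_self (T κ κ k), le_abs_self (T κ u k),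
          le_abs_self (T κ v k)]
      refine (Finset.sum_le_sum fun k _ => hle k).trans_lt ?_
      simp only [Finset.sum_add_distrib, ← Finset.mul_sum]
      linarith [hT i p, hT i q, hT κ κ, hT κ u, hT κ v, hm1 i]
  · have hPsi : ∀ s : Fin (2*N+1) → ℝ, PsiF N K η s i = η (s i) + 2 * η (s i + s i) := by
      intro s
      simp only [PsiF]
      rw [if_neg hc, vcomp_eq s i (by ring), two_mul (s i)]
    refine row_dominant_of_sum_abs_lt (d := deriv η (r i)) (B := fun k => 2 *
      (deriv η (r i + r i) * ((Pi.single k (1:ℝ) : Fin (2*N+1) → ℝ) i +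
        (Pi.single k (1:ℝ) : Fin (2*N+1) → ℝ) i))) (fun k => ?_) ?_
    · simp only [Jac, hPsi]
      rw [((hasDerivAt_comp_update r k i (hd1 i)).fun_add
        ((hasDerivAt_pair r k i i (hd2 _ _)).const_mul 2)).deriv]
    · simp only [abs_mul (2:ℝ), ← Finset.mul_sum, sum_abs_mul_single_add]
      rw [abs_two]
      linarith [hm2 i i, hm1 i]

/-- If `r̃₂/2 < r_L < r_U` and `η'(r_U) + 12η'(2r_L) ≥ 0`, then `r_U < a₁` and `DΨ̂^F(r)` is
strictly diagonally dominant with positive diagonal on the open cube `(r_L, r_U)^{2N+1}`. -/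
theorem jacobian_sdd_on_cube
    (N K : ℕ) (hK : 2 ≤ K) (hKN : K + 2 ≤ N)
    (φ η : ℝ → ℝ) (hφ : ContDiffOn ℝ 3 φ (Set.Ioi 0)) (hη : η = deriv φ)
    (r1 r2 a0 a1 : ℝ) (hA : Assump η r1 r2 a0 a1)
    (rL rU : ℝ) (h1 : r2/2 < rL) (h2 : rL < rU)
    (h3 : 0 ≤ deriv η rU + 12 * deriv η (2*rL)) :
    rU < a1 ∧
    ∀ r : Fin (2*N+1) → ℝ, (∀ k, r k ∈ Ioo rL rU) → SDD (Jac N K η r) := by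
  obtain ⟨ha0, ha0r1, hr12, hr2a, -, -, hneg, hconc, hconv, -, -, -, hhat⟩ := hA
  have hηC : ContDiffOn ℝ 2 η (Set.Ioi 0) := by
    rw [hη]; exact hφ.deriv_of_isOpen isOpen_Ioi (by norm_num)
  have hη'C : ContinuousOn (deriv η) (Set.Ioi 0) :=
    (hηC.deriv_of_isOpen (m := 1) isOpen_Ioi (by norm_num)).continuousOn
  have hdiff : ∀ x, 0 < x → DifferentiableAt ℝ η x := fun x hx =>
    (hηC.differentiableOn (by norm_num)).differentiableAt (Ioi_mem_nhds hx)
  have hanti : StrictAntiOn (deriv η) (Set.Ioc 0 r2) :=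
    strictAntiOn_of_deriv_neg (convex_Ioc 0 r2) (hη'C.mono fun x hx => hx.1)
      (by simpa only [interior_Ioc] using hconc)
  have hmono : StrictMonoOn (deriv η) (Set.Ici r2) :=
    strictMonoOn_of_deriv_pos (convex_Ici r2)
      (hη'C.mono fun x hx => lt_of_lt_of_le (by linarith) (Set.mem_Ici.1 hx))
      (by simpa only [interior_Ici] using hconv)
  have hfar : ∀ s, 2 * rL < s → |deriv η s| ≤ -deriv η (2 * rL) := by
    intro s hs
    have h := hmono (Set.mem_Ici.2 (by linarith)) (Set.mem_Ici.2 (by linarith)) hs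
    rw [abs_of_neg (hneg s (Set.mem_Ioi.2 (by linarith)))]
    linarith
  have hm : deriv η (2 * rL) < 0 := hneg _ (Set.mem_Ioi.2 (by linarith))
  have hrU : rU ≤ r1 := by
    by_contra! hlt
    linarith [hneg rU hlt]
  constructor
  · by_contra! hle
    have hcont : ContinuousAt (fun x => deriv η x + 4 * deriv η (2 * x)) rU := by
      have c1 : ContinuousAt (deriv η) rU := hη'C.continuousAt (Ioi_mem_nhds (by linarith))
      have c2 : ContinuousAt (deriv η) (2 * rU) := hη'C.continuousAt (Ioi_mem_nhds (by linarith))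
      exact c1.add (continuousAt_const.mul
        (ContinuousAt.comp (f := fun x => 2 * x) c2 (by fun_prop)))
    have hpos : 0 < deriv η rU + 4 * deriv η (2 * rU) := by
      linarith [neg_abs_le (deriv η (2 * rU)), hfar (2 * rU) (by linarith)]
    obtain ⟨x, hx, hxU⟩ := ((hcont.eventually (lt_mem_nhds hpos)).filter_mono
      nhdsWithin_le_nhds |>.and (self_mem_nhdsWithin (s := Set.Ioi rU))).exists
    have hxU' : rU < x := hxU
    have hder : HasDerivAt (etaHat η) (deriv η x + 2 * (deriv η (2 * x) * 2)) x := by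
      have hin : HasDerivAt (fun y : ℝ => 2 * y) 2 x := by
        simpa using (hasDerivAt_id x).const_mul 2
      exact (hdiff x (by linarith)).hasDerivAt.fun_add
        ((HasDerivAt.comp (h₂ := η) x (hdiff (2 * x) (by linarith)).hasDerivAt hin).const_mul 2)
    have := hhat x (Set.mem_Ioi.2 (by linarith))
    rw [hder.deriv] at this
    linarith
  · intro r hr
    refine sdd_jac_of_stiffness_bounds hKN (m := -deriv η (2 * rL))
      (fun a => hdiff _ (by linarith [(hr a).1]))
      (fun a b => hdiff _ (by linarith [(hr a).1, (hr b).1])) (fun a => ?_)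
      (fun a b => hfar _ (by linarith [(hr a).1, (hr b).1]))
    have h := hanti (a := r a) (b := rU) ⟨by linarith [(hr a).1], by linarith [(hr a).2]⟩
      ⟨by linarith, by linarith⟩ (hr a).2
    linarith
end
end

section
/- Suppose r_L and r_U satisfy r̃₂/2 < r_L < r_U and η′(r_U) + 12η′(2r_L) ≥ 0, and suppose the external forces f_j are anti-symmetric. If η(r_L) + 4η(2r_L) − 2η(2r_U) < Φ_j < η(r_U) + 4η(2r_U) − 2η(2r_L) for every j = −N,…,N, then the force-based quasicontinuum equilibrium equations F^{QCF}_j(r) + f_j = 0 for j = −N,…,N+1 have exactly one symmetric solution r in Ω = (r_L, r_U)^{2N+1}. -/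
open Finset Set

noncomputable section

/-- A map on a box `[L, U]^ι` whose difference quotients are dominated by their diagonal part and
which points outwards on the faces takes the value `Φ` in the open box. -/
theorem exists_eq_of_diagonally_dominant {ι : Type*} [Fintype ι] {L U a b M : ℝ} (hLU : L ≤ U)
    (hb : 0 ≤ b) (hba : b < a) (G : (ι → ℝ) → ι → ℝ) (Φ : ι → ℝ)
    (hG : ∀ x y : ι → ℝ, (∀ i, x i ∈ Set.Icc L U) → (∀ i, y i ∈ Set.Icc L U) → ∀ i,
      ∃ s ∈ Set.Icc a M, |G x i - G y i - s * (x i - y i)| ≤ b * dist x y)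
    (hU : ∀ x : ι → ℝ, (∀ i, x i ∈ Set.Icc L U) → ∀ i, x i = U → Φ i < G x i)
    (hL : ∀ x : ι → ℝ, (∀ i, x i ∈ Set.Icc L U) → ∀ i, x i = L → G x i < Φ i) :
    ∃ x : ι → ℝ, (∀ i, x i ∈ Set.Ioo L U) ∧ ∀ i, G x i = Φ i := by
  rcases isEmpty_or_nonempty ι with hι | ⟨⟨i₀⟩⟩
  · exact ⟨fun _ => 0, fun i => hι.elim i, fun i => hι.elim i⟩
  have haM : a ≤ M := by
    obtain ⟨s, hs, -⟩ := hG (fun _ => L) (fun _ => L) (fun _ => ⟨le_rfl, hLU⟩)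
      (fun _ => ⟨le_rfl, hLU⟩) i₀
    exact hs.1.trans hs.2
  have ha : 0 < a := hb.trans_lt hba
  have hM : 0 < M := ha.trans_le haM
  let T : (ι → ℝ) → ι → ℝ := fun x i => max L (min U (x i - (G x i - Φ i) / M))
  let B : Set (ι → ℝ) := Set.pi Set.univ fun _ => Set.Icc L U
  have hmem : ∀ x, x ∈ B ↔ ∀ i, x i ∈ Set.Icc L U := fun x => by simp only [B, Set.mem_univ_pi]
  have hT : MapsTo T B B := fun x _ => (hmem _).2 fun i =>
    ⟨le_max_left _ _, max_le hLU (min_le_left _ _)⟩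
  have hclamp : ∀ u v : ℝ, |max L (min U u) - max L (min U v)| ≤ |u - v| := fun u v => by
    refine (abs_max_sub_max_le_max L _ L _).trans ?_
    rw [sub_self, abs_zero, max_eq_right (abs_nonneg _)]
    refine (abs_min_sub_min_le_max U u U v).trans ?_
    rw [sub_self, abs_zero, max_eq_right (abs_nonneg _)]
  have hk0 : 0 ≤ 1 - (a - b) / M := by
    rw [sub_nonneg, div_le_one hM]; linarith
  have hk1 : 1 - (a - b) / M < 1 := by
    have : 0 < (a - b) / M := div_pos (by linarith) hM
    linarith
  have hcontr : ContractingWith ⟨1 - (a - b) / M, hk0⟩ (hT.restrict T B B) := by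
    refine ⟨hk1, LipschitzWith.of_dist_le_mul fun x y => ?_⟩
    change dist (T x) (T y) ≤ (1 - (a - b) / M) * dist (x : ι → ℝ) y
    have hx := (hmem _).1 x.2
    have hy := (hmem _).1 y.2
    refine (dist_pi_le_iff (mul_nonneg hk0 dist_nonneg)).2 fun i => ?_
    obtain ⟨s, hs, hsb⟩ := hG x y hx hy i
    have hd : |x.1 i - y.1 i| ≤ dist x.1 y.1 := dist_le_pi_dist x.1 y.1 i
    rw [Real.dist_eq]
    refine (hclamp _ _).trans ?_
    have hsplit : x.1 i - (G x i - Φ i) / M - (y.1 i - (G y i - Φ i) / M)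
        = (1 - s / M) * (x.1 i - y.1 i) - (G x i - G y i - s * (x.1 i - y.1 i)) / M := by
      field_simp; ring
    have hs1 : 0 ≤ 1 - s / M := by
      rw [sub_nonneg, div_le_one hM]; exact hs.2
    rw [hsplit]
    calc _ ≤ |(1 - s / M) * (x.1 i - y.1 i)| + |(G x i - G y i - s * (x.1 i - y.1 i)) / M| :=
          abs_sub _ _
      _ ≤ (1 - s / M) * dist x.1 y.1 + b * dist x.1 y.1 / M := by
          rw [abs_mul, abs_div, abs_of_nonneg hs1, abs_of_pos hM]
          gcongr
      _ = (1 - (s - b) / M) * dist x.1 y.1 := by ring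
      _ ≤ _ := by
          have := hs.1
          gcongr
  have hBc : IsComplete B := (isClosed_set_pi fun _ _ => isClosed_Icc).isComplete
  obtain ⟨x, hxB, hx, -⟩ := hcontr.exists_fixedPoint' hBc hT
    (x := fun _ => L) ((hmem _).2 fun _ => ⟨le_rfl, hLU⟩) (edist_ne_top _ _)
  rw [hmem] at hxB
  have key : ∀ i, x i ∈ Set.Ioo L U ∧ G x i = Φ i := fun i => by
    have hxi : max L (min U (x i - (G x i - Φ i) / M)) = x i := congrFun hx i
    have hneL : x i ≠ L := fun h => by
      have h1 : 0 < (Φ i - G x i) / M := div_pos (sub_pos.2 (hL x hxB i h)) hM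
      have h2 := hU x hxB i
      have h3 : x i - (G x i - Φ i) / M = x i + (Φ i - G x i) / M := by ring
      rw [h3] at hxi
      have h4 : min U (x i + (Φ i - G x i) / M) ≤ L := by
        rw [h] at hxi ⊢; exact max_eq_left_iff.1 hxi
      rcases min_le_iff.1 h4 with h5 | h5
      · exact absurd (h2 (by linarith)) (by linarith [hL x hxB i h])
      · linarith
    have hneU : x i ≠ U := fun h => by
      have h1 : 0 < (G x i - Φ i) / M := div_pos (sub_pos.2 (hU x hxB i h)) hM
      rcases max_choice L (min U (x i - (G x i - Φ i) / M)) with h2 | h2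
      · exact hneL (by linarith)
      · have := min_le_right U (x i - (G x i - Φ i) / M)
        linarith
    refine ⟨⟨lt_of_le_of_ne (hxB i).1 hneL.symm, lt_of_le_of_ne (hxB i).2 hneU⟩, ?_⟩
    have h0 : (G x i - Φ i) / M = 0 := by
      rcases max_choice L (min U (x i - (G x i - Φ i) / M)) with h2 | h2
      · exact absurd (by linarith) hneL
      · rcases min_choice U (x i - (G x i - Φ i) / M) with h3 | h3
        · exact absurd (by linarith) hneU
        · linarith
    rcases div_eq_zero_iff.1 h0 with h | h
    · linarith
    · exact absurd h hM.ne'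
  exact ⟨x, fun i => (key i).1, fun i => (key i).2⟩

/-- A map whose difference quotients are dominated by their diagonal part is injective. -/
theorem eq_of_diagonally_dominant {ι : Type*} [Fintype ι] {a b : ℝ} (hb : 0 ≤ b) (hba : b < a)
    (g x y : ι → ℝ) (hg : ∀ i, g i = 0)
    (h : ∀ i, ∃ s, a ≤ s ∧ |g i - s * (x i - y i)| ≤ b * dist x y) : x = y := by
  have ha : 0 < a := hb.trans_lt hba
  have hd : dist x y ≤ b / a * dist x y := by
    refine (dist_pi_le_iff (by positivity)).2 fun i => ?_
    obtain ⟨s, hs, hsb⟩ := h i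
    rw [hg i, zero_sub, abs_neg, abs_mul, abs_of_pos (ha.trans_le hs)] at hsb
    rw [Real.dist_eq, div_mul_eq_mul_div, le_div_iff₀ ha]
    nlinarith [abs_nonneg (x i - y i)]
  have hlt : b / a < 1 := (div_lt_one ha).2 hba
  exact dist_le_zero.1 (by nlinarith [dist_nonneg (x := x) (y := y)])

/-- Mean value theorem: bounds on the derivative bound all secant slopes. -/
theorem exists_slope_mem_Icc {g : ℝ → ℝ} {p q A B : ℝ}
    (hg : ∀ x ∈ Set.Icc p q, DifferentiableAt ℝ g x)
    (hAB : ∀ x ∈ Set.Icc p q, deriv g x ∈ Set.Icc A B)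
    {x y : ℝ} (hx : x ∈ Set.Icc p q) (hy : y ∈ Set.Icc p q) :
    ∃ s ∈ Set.Icc A B, g x - g y = s * (x - y) := by
  have key : ∀ u v, u ∈ Set.Icc p q → v ∈ Set.Icc p q → u < v →
      ∃ s ∈ Set.Icc A B, g v - g u = s * (v - u) := fun u v hu hv huv => by
    have hsub : Set.Icc u v ⊆ Set.Icc p q := Set.Icc_subset_Icc hu.1 hv.2
    obtain ⟨c, hc, hcs⟩ := exists_deriv_eq_slope g huv
      (fun z hz => (hg z (hsub hz)).continuousAt.continuousWithinAt)
      (fun z hz => (hg z (hsub (Set.Ioo_subset_Icc_self hz))).differentiableWithinAt)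
    refine ⟨deriv g c, hAB c (hsub (Set.Ioo_subset_Icc_self hc)), ?_⟩
    rw [hcs, div_mul_cancel₀ _ (sub_ne_zero.2 huv.ne')]
  rcases lt_trichotomy x y with h | h | h
  · obtain ⟨s, hs, hs'⟩ := key x y hx hy h
    exact ⟨s, hs, by linarith⟩
  · exact ⟨deriv g x, hAB x hx, by rw [h]; ring⟩
  · exact key y x hy hx h

/-- The conjugate force at the integer site `j` of a symmetric `ℤ`-indexed family `c`. -/
def conjForce (K : ℕ) (η : ℝ → ℝ) (c : ℤ → ℝ) (j : ℤ) : ℝ :=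
  if |j| < (K:ℤ) then
    η (c j) + η (c j + c (j-1)) + η (c j + c (j+1))
      + (2 * η (2 * c (K:ℤ)) - η (c (K:ℤ) + c ((K:ℤ)-1)) - η (c (K:ℤ) + c ((K:ℤ)+1)))
  else η (c j) + 2 * η (2 * c j)

theorem conjForce_neg (K : ℕ) (η : ℝ → ℝ) {c : ℤ → ℝ} (hc : ∀ j, c (-j) = c j) (j : ℤ) :
    conjForce K η c (-j) = conjForce K η c j := by
  have h1 : c (-j - 1) = c (j + 1) := by rw [← hc]; congr 1; ring
  have h2 : c (-j + 1) = c (j - 1) := by rw [← hc]; congr 1; ring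
  simp only [conjForce, abs_neg, hc, h1, h2]
  split_ifs <;> ring

/-- The quasicontinuum forces are differences of conjugate forces. -/
theorem FQCFr_eq_sub (N K : ℕ) (hK : 1 ≤ K) (η : ℝ → ℝ) {c : ℤ → ℝ}
    (hc : ∀ j, c (-j) = c j) (j : ℤ) (h1 : -(N:ℤ) < j) (h2 : j ≤ N) :
    FQCFr N K η c j = conjForce K η c j - conjForce K η c (j-1) := by
  have e1 : j - 1 - 1 = j - 2 := by ring
  have e2 : j - 1 + 1 = j := by ring
  rw [FQCFr, if_neg (by omega), if_neg (by omega)]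
  rcases lt_trichotomy j (-(K:ℤ)+1) with h | h | h
  · rw [if_neg (by omega), conjForce, conjForce, if_neg (by rw [abs_lt]; omega),
      if_neg (by rw [abs_lt]; omega)]
  · have hk0 : c (j - 1) = c (K:ℤ) := by rw [← hc]; congr 1; omega
    have hk1 : c j = c ((K:ℤ) - 1) := by rw [← hc]; congr 1; omega
    have hk2 : c (j - 2) = c ((K:ℤ) + 1) := by rw [← hc]; congr 1; omega
    rw [if_pos (by omega), conjForce, conjForce, if_pos (by rw [abs_lt]; omega),
      if_neg (by rw [abs_lt]; omega), hk0, hk1, hk2, add_comm (c ((K:ℤ) - 1)) (c K)]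
    ring
  · rcases lt_trichotomy j K with h' | h' | h'
    · rw [if_pos (by omega), conjForce, conjForce, if_pos (by rw [abs_lt]; omega),
        if_pos (by rw [abs_lt]; omega), e1, e2, add_comm (c j) (c (j-1))]
      ring
    · subst h'
      rw [if_pos (by omega), conjForce, conjForce, if_neg (by rw [abs_lt]; omega),
        if_pos (by rw [abs_lt]; omega), e1, e2, add_comm (c K) (c (K-1))]
      ring
    · rw [if_neg (by omega), conjForce, conjForce, if_neg (by rw [abs_lt]; omega),
        if_neg (by rw [abs_lt]; omega)]

theorem FQCFr_first (N K : ℕ) (hKN : K < N) (η : ℝ → ℝ) (c : ℤ → ℝ) :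
    FQCFr N K η c (-(N:ℤ)) = conjForce K η c (-(N:ℤ)) := by
  rw [FQCFr, if_pos rfl, conjForce, if_neg (by rw [abs_lt]; omega)]

theorem FQCFr_last (N K : ℕ) (hKN : K < N) (η : ℝ → ℝ) (c : ℤ → ℝ) :
    FQCFr N K η c ((N:ℤ)+1) = -conjForce K η c N := by
  rw [FQCFr, if_neg (by omega), if_pos rfl, conjForce, if_neg (by rw [abs_lt]; omega),
    add_sub_cancel_right]

theorem FQCFr_congr (N K : ℕ) (hKN : K < N) (η : ℝ → ℝ) {c c' : ℤ → ℝ}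
    (h : ∀ j : ℤ, -(N:ℤ) ≤ j → j ≤ N → c j = c' j) (j : ℤ) (h1 : -(N:ℤ) ≤ j) (h2 : j ≤ (N:ℤ)+1) :
    FQCFr N K η c j = FQCFr N K η c' j := by
  unfold FQCFr
  split_ifs with ha hb hd
  · rw [h j (by omega) (by omega)]
  · rw [h (j-1) (by omega) (by omega)]
  · rw [h j (by omega) (by omega), h (j-1) (by omega) (by omega), h (j-2) (by omega) (by omega),
      h (j+1) (by omega) (by omega)]
  · rw [h j (by omega) (by omega), h (j-1) (by omega) (by omega)]

theorem sum_Icc_int_succ (f : ℤ → ℝ) {a j : ℤ} (h : a ≤ j + 1) :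
    ∑ i ∈ Finset.Icc a (j+1), f i = (∑ i ∈ Finset.Icc a j, f i) + f (j+1) := by
  have : Finset.Icc a (j+1) = insert (j+1) (Finset.Icc a j) := by
    ext i; simp only [Finset.mem_Icc, Finset.mem_insert]; omega
  rw [this, Finset.sum_insert (by simp), add_comm]

/-- For a symmetric family, equilibrium is equivalent to prescribing the conjugate forces. -/
theorem equilibrium_iff_conjForce (N K : ℕ) (hK : 1 ≤ K) (hKN : K < N) (η : ℝ → ℝ) {c : ℤ → ℝ}
    (hc : ∀ j, c (-j) = c j) (f : ℤ → ℝ)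
    (hsum : ∑ j ∈ Finset.Icc (-(N:ℤ)) ((N:ℤ)+1), f j = 0) :
    (∀ j : ℤ, -(N:ℤ) ≤ j → j ≤ (N:ℤ)+1 → FQCFr N K η c j + f j = 0) ↔
      ∀ j : ℤ, -(N:ℤ) ≤ j → j ≤ N →
        conjForce K η c j = -∑ i ∈ Finset.Icc (-(N:ℤ)) j, f i := by
  constructor
  · intro h j hj
    induction j, hj using Int.leInduction with
    | base =>
      intro _
      have := h (-(N:ℤ)) le_rfl (by omega)
      rw [FQCFr_first N K hKN] at this
      rw [Finset.Icc_self, Finset.sum_singleton]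
      linarith
    | succ j hj ih =>
      intro hjN
      have := h (j+1) (by omega) (by omega)
      rw [FQCFr_eq_sub N K hK η hc (j+1) (by omega) hjN, add_sub_cancel_right,
        ih (by omega)] at this
      rw [sum_Icc_int_succ f (by omega)]
      linarith
  · intro h j h1 h2
    rcases eq_or_lt_of_le h1 with rfl | h1'
    · rw [FQCFr_first N K hKN, h _ le_rfl (by omega), Finset.Icc_self, Finset.sum_singleton]
      ring
    · rcases eq_or_lt_of_le h2 with rfl | h2'
      · rw [sum_Icc_int_succ f (by omega)] at hsum
        rw [FQCFr_last N K hKN, h _ (by omega) le_rfl]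
        linarith
      · obtain ⟨i, rfl⟩ : ∃ i, j = i + 1 := ⟨j - 1, by ring⟩
        rw [FQCFr_eq_sub N K hK η hc _ h1' (by omega), h _ (by omega) (by omega),
          add_sub_cancel_right, h i (by omega) (by omega), sum_Icc_int_succ f (by omega)]
        ring

/-- Conjugate forces of anti-symmetric forces are symmetric. -/
theorem sum_Icc_neg_eq (N : ℕ) (f : ℤ → ℝ)
    (hanti : ∀ j : ℤ, 0 ≤ j → j ≤ (N:ℤ) → f (j+1) = - f (-j)) (j : ℤ) (h0 : 0 ≤ j) :
    j ≤ N → ∑ i ∈ Finset.Icc (-(N:ℤ)) (-j), f i = ∑ i ∈ Finset.Icc (-(N:ℤ)) j, f i := by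
  induction j, h0 using Int.leInduction with
  | base => intro _; rw [neg_zero]
  | succ j hj ih =>
    intro hjN
    have h1 := sum_Icc_int_succ f (a := -(N:ℤ)) (j := -(j+1)) (by omega)
    rw [show -(j+1)+1 = -j by ring] at h1
    rw [sum_Icc_int_succ f (by omega), hanti j hj (by omega), ← ih (by omega), h1]
    ring

/-- The even extension to `ℤ` of a family indexed by `0, …, N`. -/
def evenExt (N : ℕ) (x : Fin (N+1) → ℝ) (j : ℤ) : ℝ := x (Fin.ofNat (N+1) j.natAbs)

theorem evenExt_neg (N : ℕ) (x : Fin (N+1) → ℝ) (j : ℤ) : evenExt N x (-j) = evenExt N x j := by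
  rw [evenExt, evenExt, Int.natAbs_neg]

theorem evenExt_coe (N : ℕ) (x : Fin (N+1) → ℝ) (i : Fin (N+1)) :
    evenExt N x ((i:ℕ):ℤ) = x i := by
  rw [evenExt, Int.natAbs_natCast]
  congr 1
  exact Fin.ext (Nat.mod_eq_of_lt i.2)

theorem vcomp_sub (N : ℕ) (r : Fin (2*N+1) → ℝ) (k : Fin (2*N+1)) :
    vcomp N r ((k:ℕ) - (N:ℤ)) = r k := by
  have h : (((k:ℕ):ℤ) - N + N).toNat = k := by simp
  simp only [vcomp, h, k.2, dite_true]

theorem vcomp_of_forall (N : ℕ) (c : ℤ → ℝ) (j : ℤ) (h1 : -(N:ℤ) ≤ j) (h2 : j ≤ N) :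
    vcomp N (fun k => c ((k:ℕ) - (N:ℤ))) j = c j := by
  rw [vcomp, dif_pos (by omega)]
  congr 1
  simp only
  omega

theorem vcomp_eq_evenExt (N : ℕ) {r : Fin (2*N+1) → ℝ} (hr : SymVec N r) (j : ℤ)
    (h1 : -(N:ℤ) ≤ j) (h2 : j ≤ N) :
    vcomp N r j = evenExt N (fun i => vcomp N r (i:ℕ)) j := by
  have hnn : ∀ j : ℤ, 0 ≤ j → j ≤ N → vcomp N r j = evenExt N (fun i => vcomp N r (i:ℕ)) j := by
    intro j h0 hN
    lift j to ℕ using h0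
    exact (evenExt_coe N (fun i => vcomp N r (i:ℕ)) ⟨j, by omega⟩).symm
  rcases le_or_gt 0 j with h | h
  · exact hnn j h h2
  · rw [← evenExt_neg, ← hnn (-j) (by omega) (by omega), ← hr (-j) (by omega) (by omega), neg_neg]

theorem evenExt_mem (N : ℕ) {x : Fin (N+1) → ℝ} {S : Set ℝ} (hx : ∀ i, x i ∈ S) (j : ℤ) :
    evenExt N x j ∈ S := hx _

theorem abs_evenExt_sub_le (N : ℕ) (x y : Fin (N+1) → ℝ) (j : ℤ) :
    |evenExt N x j - evenExt N y j| ≤ dist x y := dist_le_pi_dist x y _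

theorem abs_slope_mul_add_le {μ s d e δ : ℝ} (hs : s ∈ Set.Icc (-μ) 0) (hd : |d| ≤ δ)
    (he : |e| ≤ δ) : |s * (d + e)| ≤ 2 * μ * δ := by
  have h1 : |s| ≤ μ := abs_le.2 ⟨hs.1, by linarith [hs.1, hs.2]⟩
  have h2 : |d + e| ≤ 2 * δ := (abs_add_le d e).trans (by linarith)
  rw [abs_mul]
  calc |s| * |d + e| ≤ μ * (2 * δ) :=
        mul_le_mul h1 h2 (abs_nonneg _) ((abs_nonneg _).trans h1)
    _ = _ := by ring

theorem abs_interface_slope_le {μ s t u d e g δ : ℝ} (hs : s ∈ Set.Icc (-μ) 0)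
    (ht : t ∈ Set.Icc (-μ) 0) (hu : u ∈ Set.Icc (-μ) 0) (hd : |d| ≤ δ) (he : |e| ≤ δ)
    (hg : |g| ≤ δ) : |2 * (s * (2 * d)) - t * (d + e) - u * (d + g)| ≤ 4 * μ * δ := by
  have hδ : 0 ≤ δ := (abs_nonneg d).trans hd
  have h1 : |(4 * s - t - u) * d| ≤ |4 * s - t - u| * δ := by rw [abs_mul]; gcongr
  have h2 : |t * e| ≤ -t * δ := by rw [abs_mul, abs_of_nonpos ht.2]; gcongr; linarith [ht.2]
  have h3 : |u * g| ≤ -u * δ := by rw [abs_mul, abs_of_nonpos hu.2]; gcongr; linarith [hu.2]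
  have h4 : |4 * s - t - u| ≤ 4 * μ + t + u :=
    abs_le.2 ⟨by linarith [hs.1, ht.1, hu.1], by linarith [hs.2, hs.1, ht.1, hu.1]⟩
  have h5 : |4 * s - t - u| * δ ≤ (4 * μ + t + u) * δ := by gcongr
  have h6 : 2 * (s * (2 * d)) - t * (d + e) - u * (d + g)
      = (4 * s - t - u) * d - t * e - u * g := by ring
  rw [h6]
  refine (abs_sub _ _).trans ?_
  have := abs_sub ((4 * s - t - u) * d) (t * e)
  linarith

/-- The conjugate force map is diagonally dominant when nearest-neighbour slopes dominate
next-nearest-neighbour slopes. -/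
theorem conjForce_diagonally_dominant (K : ℕ) {η : ℝ → ℝ} {L U μ A M δ : ℝ} (hμ : 0 ≤ μ)
    (hs : ∀ x ∈ Set.Icc L U, ∀ y ∈ Set.Icc L U, ∃ s ∈ Set.Icc A M, η x - η y = s * (x - y))
    (ht : ∀ x ∈ Set.Icc (2*L) (2*U), ∀ y ∈ Set.Icc (2*L) (2*U),
      ∃ s ∈ Set.Icc (-μ) 0, η x - η y = s * (x - y))
    {c d : ℤ → ℝ} (hc : ∀ j, c j ∈ Set.Icc L U) (hd : ∀ j, d j ∈ Set.Icc L U)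
    (hδ : ∀ j, |c j - d j| ≤ δ) (j : ℤ) :
    ∃ s ∈ Set.Icc A M,
      |conjForce K η c j - conjForce K η d j - s * (c j - d j)| ≤ 8 * μ * δ := by
  obtain ⟨s, hsm, hse⟩ := hs _ (hc j) _ (hd j)
  refine ⟨s, hsm, ?_⟩
  have hδ0 : 0 ≤ δ := (abs_nonneg _).trans (hδ 0)
  have hμδ : 0 ≤ μ * δ := mul_nonneg hμ hδ0
  have pair : ∀ i k, ∃ t ∈ Set.Icc (-μ) 0,
      η (c i + c k) - η (d i + d k) = t * ((c i - d i) + (c k - d k)) := fun i k => by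
    obtain ⟨t, htm, hte⟩ := ht (c i + c k)
      ⟨by linarith [(hc i).1, (hc k).1], by linarith [(hc i).2, (hc k).2]⟩ (d i + d k)
      ⟨by linarith [(hd i).1, (hd k).1], by linarith [(hd i).2, (hd k).2]⟩
    exact ⟨t, htm, by rw [hte]; ring⟩
  have double : ∀ i, ∃ t ∈ Set.Icc (-μ) 0,
      η (2 * c i) - η (2 * d i) = t * (2 * (c i - d i)) := fun i => by
    obtain ⟨t, htm, hte⟩ := pair i i
    exact ⟨t, htm, by rw [two_mul, two_mul, two_mul, hte]⟩
  unfold conjForce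
  split_ifs
  · obtain ⟨t₁, ht₁, e₁⟩ := pair j (j-1)
    obtain ⟨t₂, ht₂, e₂⟩ := pair j (j+1)
    obtain ⟨u₀, hu₀, g₀⟩ := double K
    obtain ⟨u₁, hu₁, g₁⟩ := pair K ((K:ℤ)-1)
    obtain ⟨u₂, hu₂, g₂⟩ := pair K ((K:ℤ)+1)
    have b₁ := abs_le.1 (abs_slope_mul_add_le ht₁ (hδ j) (hδ (j-1)))
    have b₂ := abs_le.1 (abs_slope_mul_add_le ht₂ (hδ j) (hδ (j+1)))
    have b₃ := abs_le.1
      (abs_interface_slope_le hu₀ hu₁ hu₂ (hδ K) (hδ ((K:ℤ)-1)) (hδ ((K:ℤ)+1)))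
    rw [← e₁] at b₁
    rw [← e₂] at b₂
    rw [← g₀, ← g₁, ← g₂] at b₃
    rw [← hse]
    exact abs_le.2 ⟨by linarith [b₁.1, b₂.1, b₃.1], by linarith [b₁.2, b₂.2, b₃.2]⟩
  · obtain ⟨t, htm, e⟩ := double j
    have b := abs_le.1 (abs_slope_mul_add_le htm (hδ j) (hδ j))
    rw [← two_mul, ← e] at b
    rw [← hse]
    exact abs_le.2 ⟨by linarith [b.1], by linarith [b.2]⟩

theorem conjForce_bounds (K : ℕ) {η : ℝ → ℝ} {L U : ℝ}
    (hη : AntitoneOn η (Set.Icc (2*L) (2*U))) {c : ℤ → ℝ} (hc : ∀ j, c j ∈ Set.Icc L U) (j : ℤ) :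
    η (c j) + 4 * η (2*U) - 2 * η (2*L) ≤ conjForce K η c j ∧
      conjForce K η c j ≤ η (c j) + 4 * η (2*L) - 2 * η (2*U) := by
  have hLU : L ≤ U := (hc 0).1.trans (hc 0).2
  have hL : 2*L ∈ Set.Icc (2*L) (2*U) := ⟨le_rfl, by linarith⟩
  have hU : 2*U ∈ Set.Icc (2*L) (2*U) := ⟨by linarith, le_rfl⟩
  have pair : ∀ i k, η (2*U) ≤ η (c i + c k) ∧ η (c i + c k) ≤ η (2*L) := fun i k => by
    have hm : c i + c k ∈ Set.Icc (2*L) (2*U) :=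
      ⟨by linarith [(hc i).1, (hc k).1], by linarith [(hc i).2, (hc k).2]⟩
    exact ⟨hη hm hU hm.2, hη hL hm hm.1⟩
  unfold conjForce
  split_ifs
  · have p₁ := pair j (j-1)
    have p₂ := pair j (j+1)
    have p₃ := pair K K
    have p₄ := pair K ((K:ℤ)-1)
    have p₅ := pair K ((K:ℤ)+1)
    rw [← two_mul] at p₃
    exact ⟨by linarith [p₁.1, p₂.1, p₃.1, p₄.2, p₅.2], by linarith [p₁.2, p₂.2, p₃.2, p₄.1, p₅.1]⟩
  · have p := pair j j
    rw [← two_mul] at p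
    exact ⟨by linarith [p.1, p.2], by linarith [p.1, p.2]⟩

/-- Secant slopes of `η` on the range of the nearest and next-nearest neighbour distances. -/
theorem slopes_of_assump {φ η : ℝ → ℝ} (hφ : ContDiffOn ℝ 3 φ (Set.Ioi 0)) (hη : η = deriv φ)
    {r1 r2 a0 a1 : ℝ} (hA : Assump η r1 r2 a0 a1) {rL rU : ℝ} (h1 : r2/2 < rL) (h2 : rL < rU)
    (h3 : 0 ≤ deriv η rU + 12 * deriv η (2*rL)) :
    ∃ μ > 0, ∃ M,
      (∀ x ∈ Set.Icc rL rU, ∀ y ∈ Set.Icc rL rU,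
        ∃ s ∈ Set.Icc (12*μ) M, η x - η y = s * (x - y)) ∧
      ∀ x ∈ Set.Icc (2*rL) (2*rU), ∀ y ∈ Set.Icc (2*rL) (2*rU),
        ∃ s ∈ Set.Icc (-μ) 0, η x - η y = s * (x - y) := by
  obtain ⟨ha0, har, hr12, -, -, -, hneg, hconc, hconv, -⟩ := hA
  have hη2 : ContDiffOn ℝ 2 η (Set.Ioi 0) := by
    rw [hη]; exact hφ.deriv_of_isOpen isOpen_Ioi (by norm_num)
  have hη1 : ContDiffOn ℝ 1 (deriv η) (Set.Ioi 0) := hη2.deriv_of_isOpen isOpen_Ioi (by norm_num)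
  have hdiff : ∀ x, 0 < x → DifferentiableAt ℝ η x := fun x hx =>
    (hη2.differentiableOn (by norm_num)).differentiableAt (Ioi_mem_nhds hx)
  have hdiff' : DifferentiableOn ℝ (deriv η) (Set.Ioi 0) := hη1.differentiableOn (by norm_num)
  have hμ : deriv η (2*rL) < 0 := hneg _ (Set.mem_Ioi.2 (by linarith))
  have hU1 : rU ≤ r1 := by
    by_contra! h
    linarith [hneg rU h]
  have hsub₁ : Set.Ioo 0 r2 ⊆ Set.Ioi (0:ℝ) := fun x hx => hx.1
  have hsub₂ : Set.Ioi r2 ⊆ Set.Ioi (0:ℝ) := Set.Ioi_subset_Ioi (by linarith)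
  have anti : AntitoneOn (deriv η) (Set.Ioo 0 r2) :=
    antitoneOn_of_deriv_nonpos (convex_Ioo _ _) (hdiff'.continuousOn.mono hsub₁)
      (by rw [interior_Ioo]; exact hdiff'.mono hsub₁)
      (by rw [interior_Ioo]; exact fun x hx => (hconc x hx).le)
  have mono : MonotoneOn (deriv η) (Set.Ioi r2) :=
    monotoneOn_of_deriv_nonneg (convex_Ioi _) (hdiff'.continuousOn.mono hsub₂)
      (by rw [interior_Ioi]; exact hdiff'.mono hsub₂)
      (by rw [interior_Ioi]; exact fun x hx => (hconv x hx).le)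
  have hmem : ∀ x ∈ Set.Icc rL rU, x ∈ Set.Ioo 0 r2 := fun x hx =>
    ⟨by linarith [hx.1], by linarith [hx.2]⟩
  refine ⟨-deriv η (2*rL), by linarith, deriv η rL, fun x hx y hy => ?_, fun x hx y hy => ?_⟩
  · refine exists_slope_mem_Icc (fun z hz => hdiff z (hmem z hz).1) (fun z hz => ?_) hx hy
    have hz1 := anti (hmem z hz) (hmem rU ⟨h2.le, le_rfl⟩) hz.2
    have hz2 := anti (hmem rL ⟨le_rfl, h2.le⟩) (hmem z hz) hz.1
    exact ⟨by linarith, hz2⟩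
  · refine exists_slope_mem_Icc (fun z hz => hdiff z (by linarith [hz.1])) (fun z hz => ?_) hx hy
    have hz1 : r2 < z := by linarith [hz.1]
    refine ⟨?_, (hneg z (Set.mem_Ioi.2 (by linarith))).le⟩
    rw [neg_neg]
    exact mono (Set.mem_Ioi.2 (by linarith)) hz1 hz.1

/-- Corollary: for anti-symmetric external forces whose conjugate forces `Φ_j` lie within the
stated bounds, the force-based quasicontinuum equilibrium equations have exactly one symmetric
solution in `Ω = (r_L, r_U)^{2N+1}`. -/
theorem equilibrium_unique_symmetric_solution
    (N K : ℕ) (hK : 2 ≤ K) (hKN : K + 2 ≤ N)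
    (φ η : ℝ → ℝ) (hφ : ContDiffOn ℝ 3 φ (Set.Ioi 0)) (hη : η = deriv φ)
    (r1 r2 a0 a1 : ℝ) (hA : Assump η r1 r2 a0 a1)
    (rL rU : ℝ) (h1 : r2/2 < rL) (h2 : rL < rU)
    (h3 : 0 ≤ deriv η rU + 12 * deriv η (2*rL))
    (f : ℤ → ℝ)
    (hsum : ∑ j ∈ Finset.Icc (-(N:ℤ)) ((N:ℤ)+1), f j = 0)
    (hanti : ∀ j : ℤ, 0 ≤ j → j ≤ (N:ℤ) → f (j+1) = - f (-j))
    (hΦ : ∀ j : ℤ, -(N:ℤ) ≤ j → j ≤ (N:ℤ) →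
      η rL + 4*η (2*rL) - 2*η (2*rU) < -(∑ i ∈ Finset.Icc (-(N:ℤ)) j, f i) ∧
      -(∑ i ∈ Finset.Icc (-(N:ℤ)) j, f i) < η rU + 4*η (2*rU) - 2*η (2*rL)) :
    ∃! r : Fin (2*N+1) → ℝ, (∀ k, r k ∈ Ioo rL rU) ∧ SymVec N r ∧
      ∀ j : ℤ, -(N:ℤ) ≤ j → j ≤ (N:ℤ)+1 → FQCFr N K η (vcomp N r) j + f j = 0 := by
  obtain ⟨μ, hμ, M, hs, ht⟩ := slopes_of_assump hφ hη hA h1 h2 h3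
  have hK1 : 1 ≤ K := by omega
  have hKN1 : K < N := by omega
  have hanti' : AntitoneOn η (Set.Icc (2*rL) (2*rU)) := fun x hx y hy hxy => by
    obtain ⟨s, hsm, hse⟩ := ht x hx y hy
    have : 0 ≤ s * (x - y) := mul_nonneg_of_nonpos_of_nonpos hsm.2 (by linarith)
    linarith
  have hdom : ∀ x y : Fin (N+1) → ℝ, (∀ i, x i ∈ Set.Icc rL rU) → (∀ i, y i ∈ Set.Icc rL rU) →
      ∀ i : Fin (N+1), ∃ s ∈ Set.Icc (12*μ) M,
        |conjForce K η (evenExt N x) (i:ℕ) - conjForce K η (evenExt N y) (i:ℕ) - s * (x i - y i)|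
          ≤ 8 * μ * dist x y := fun x y hx hy i => by
    have := conjForce_diagonally_dominant K hμ.le hs ht (evenExt_mem N hx) (evenExt_mem N hy)
      (abs_evenExt_sub_le N x y) (i:ℕ)
    rwa [evenExt_coe, evenExt_coe] at this
  obtain ⟨x, hxB, hx⟩ := exists_eq_of_diagonally_dominant h2.le (b := 8 * μ) (a := 12 * μ) (M := M)
    (by linarith) (by linarith) (fun x (i : Fin (N+1)) => conjForce K η (evenExt N x) (i:ℕ))
    (fun i => -∑ k ∈ Finset.Icc (-(N:ℤ)) (i:ℕ), f k) hdom
    (fun x hx i hi => by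
      have hb := (conjForce_bounds K hanti' (evenExt_mem N hx) (i:ℕ)).1
      rw [evenExt_coe, hi] at hb
      exact (hΦ (i:ℕ) (by omega) (by omega)).2.trans_le hb)
    (fun x hx i hi => by
      have hb := (conjForce_bounds K hanti' (evenExt_mem N hx) (i:ℕ)).2
      rw [evenExt_coe, hi] at hb
      exact hb.trans_lt (hΦ (i:ℕ) (by omega) (by omega)).1)
  have hv := vcomp_of_forall N (evenExt N x)
  refine ⟨fun k => evenExt N x ((k:ℕ) - (N:ℤ)),
    ⟨fun k => evenExt_mem N hxB _, fun j hj1 hj2 => ?_, fun j hj1 hj2 => ?_⟩, ?_⟩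
  · rw [hv _ (by omega) (by omega), hv _ (by omega) (by omega), evenExt_neg]
  · rw [FQCFr_congr N K hKN1 η hv j hj1 hj2]
    refine (equilibrium_iff_conjForce N K hK1 hKN1 η (evenExt_neg N x) f hsum).2 ?_ j hj1 hj2
    have hnn : ∀ j : ℤ, 0 ≤ j → j ≤ N →
        conjForce K η (evenExt N x) j = -∑ i ∈ Finset.Icc (-(N:ℤ)) j, f i := fun j h0 hN => by
      lift j to ℕ using h0
      exact hx ⟨j, by omega⟩
    intro j hj1 hj2
    rcases le_or_gt 0 j with h | h
    · exact hnn j h hj2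
    · rw [← conjForce_neg K η (evenExt_neg N x), hnn (-j) (by omega) (by omega),
        ← sum_Icc_neg_eq N f hanti (-j) (by omega) (by omega), neg_neg]
  · rintro r ⟨hrB, hrS, hrE⟩
    have hve := vcomp_eq_evenExt N hrS
    have hyB : ∀ i : Fin (N+1), vcomp N r (i:ℕ) ∈ Set.Ioo rL rU := fun i => by
      rw [vcomp, dif_pos (by omega)]
      exact hrB _
    have hyE := (equilibrium_iff_conjForce N K hK1 hKN1 η
      (evenExt_neg N fun i => vcomp N r (i:ℕ)) f hsum).1 fun j hj1 hj2 => by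
        rw [← FQCFr_congr N K hKN1 η hve j hj1 hj2]
        exact hrE j hj1 hj2
    have hyx : (fun i : Fin (N+1) => vcomp N r (i:ℕ)) = x :=
      eq_of_diagonally_dominant (a := 12 * μ) (b := 8 * μ) (by linarith) (by linarith)
        (fun i : Fin (N+1) => conjForce K η (evenExt N fun i => vcomp N r (i:ℕ)) (i:ℕ)
          - conjForce K η (evenExt N x) (i:ℕ)) _ _
        (fun i => sub_eq_zero.2 ((hyE (i:ℕ) (by omega) (by omega)).trans (hx i).symm))
        (fun i => by
          obtain ⟨s, hsm, hsb⟩ := hdom (fun i => vcomp N r (i:ℕ)) x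
            (fun i => Set.Ioo_subset_Icc_self (hyB i)) (fun i => Set.Ioo_subset_Icc_self (hxB i)) i
          exact ⟨s, hsm.1, hsb⟩)
    funext k
    rw [← vcomp_sub N r k, hve _ (by omega) (by omega), hyx]
end
end

section
/- Suppose r_L and r_U satisfy r̃₂/2 < r_L < r_U and η′(r_U) + 13η′(2r_L) > 0, and suppose Φ ∈ ℝ^{2N+1} satisfies η(r_L) + 4η(2r_L) − 2η(2r_U) < Φ_j < η(r_U) + 4η(2r_U) − 2η(2r_L) for every j = −N,…,N. Then for every rⁿ ∈ Ω = (r_L, r_U)^{2N+1} there is a unique rⁿ⁺¹ ∈ Ω such that Ψ̂^E(rⁿ⁺¹) + Ψ̂^G(rⁿ) = Φ. Moreover, the induced mapping rⁿ ↦ rⁿ⁺¹ on Ω is a contraction in the maximum norm: for all rⁿ, sⁿ ∈ Ω with images rⁿ⁺¹, sⁿ⁺¹, one has ‖rⁿ⁺¹ − sⁿ⁺¹‖_∞ ≤ (8|η′(2r_L)| / (η′(r_U) − 5|η′(2r_L)|)) ‖rⁿ − sⁿ‖_∞, and 8|η′(2r_L)| / (η′(r_U) − 5|η′(2r_L)|)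 < 1. -/
open Finset Set

noncomputable section

/-- On `[rL, rU]` the secant slopes of `η` lie in `[m, L]`, and on `[2 rL, 2 rU]` they lie in
`[-M, 0]`. -/
structure SecantBounds (η : ℝ → ℝ) (rL rU m L M : ℝ) : Prop where
  near : ∀ x ∈ Icc rL rU, ∀ y ∈ Icc rL rU, ∃ a, m ≤ a ∧ a ≤ L ∧ η x - η y = a * (x - y)
  far : ∀ x ∈ Icc (2 * rL) (2 * rU), ∀ y ∈ Icc (2 * rL) (2 * rU),
    ∃ q, 0 ≤ q ∧ q ≤ M ∧ η x - η y = -q * (x - y)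

/-- The common shape of a row of the system: the energy-based part is
`η(r_c) + α η(2 r_c) + β η(r_c + r_p) + γ η(r_c + r_q)`, and the ghost-force part is a combination
of the same second-neighbour terms and of the interface term centred at `k`. -/
structure GhostRow (ι : Type*) where
  (c p q k k₁ k₂ : ι)
  (α β γ δ ε ζ θ : ℝ)
  α_nonneg : 0 ≤ α
  β_nonneg : 0 ≤ β
  γ_nonneg : 0 ≤ γ
  θ_nonneg : 0 ≤ θ
  energy_le : 2 * (α + β + γ) ≤ 5
  ghost_le : |δ| + |ε| + |ζ| + 2 * θ ≤ 4
  total_eq : α + β + γ + (δ + ε + ζ) = 2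
  total_le : α + β + γ + (|δ| + |ε| + |ζ| + 4 * θ) ≤ 6

namespace GhostRow

variable {ι : Type*} (R : GhostRow ι) (η : ℝ → ℝ) (r : ι → ℝ)

/-- The energy-based part of a row. -/
def energy : ℝ :=
  η (r R.c) + R.α * η (2 * r R.c) + R.β * η (r R.c + r R.p) + R.γ * η (r R.c + r R.q)

/-- The ghost-force part of a row. -/
def ghost : ℝ :=
  R.δ * η (2 * r R.c) + R.ε * η (r R.c + r R.p) + R.ζ * η (r R.c + r R.q)
    + R.θ * (2 * η (2 * r R.k) - η (r R.k + r R.k₁) - η (r R.k + r R.k₂))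

end GhostRow

lemma two_mul_mem_Icc_two_mul {rL rU x : ℝ} (hx : x ∈ Icc rL rU) :
    2 * x ∈ Icc (2 * rL) (2 * rU) := ⟨by linarith [hx.1], by linarith [hx.2]⟩

lemma add_mem_Icc_two_mul {rL rU x y : ℝ} (hx : x ∈ Icc rL rU) (hy : y ∈ Icc rL rU) :
    x + y ∈ Icc (2 * rL) (2 * rU) :=
  ⟨by linarith [hx.1, hy.1], by linarith [hx.2, hy.2]⟩

namespace SecantBounds

variable {η : ℝ → ℝ} {rL rU m L M : ℝ}

lemma antitone_far (h : SecantBounds η rL rU m L M) {x y : ℝ}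
    (hx : x ∈ Icc (2 * rL) (2 * rU)) (hy : y ∈ Icc (2 * rL) (2 * rU)) (hxy : x ≤ y) :
    η y ≤ η x := by
  obtain ⟨q, hq, -, e⟩ := h.far y hy x hx
  nlinarith [mul_nonneg hq (sub_nonneg.2 hxy)]

lemma abs_far_le (h : SecantBounds η rL rU m L M) {x y D : ℝ}
    (hx : x ∈ Icc (2 * rL) (2 * rU)) (hy : y ∈ Icc (2 * rL) (2 * rU)) (hD : |x - y| ≤ 2 * D) :
    |η x - η y| ≤ 2 * M * D := by
  obtain ⟨q, hq, hqM, e⟩ := h.far x hx y hy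
  rw [e, abs_mul, abs_neg, abs_of_nonneg hq]
  nlinarith [mul_le_mul hqM hD (abs_nonneg _) (hq.trans hqM)]

lemma abs_far_sub_midpoint_le (h : SecantBounds η rL rU m L M) {x : ℝ}
    (hx : x ∈ Icc (2 * rL) (2 * rU)) :
    |η x - (η (2 * rL) + η (2 * rU)) / 2| ≤ (η (2 * rL) - η (2 * rU)) / 2 := by
  have hLU := hx.1.trans hx.2
  have h₁ := h.antitone_far (left_mem_Icc.2 hLU) hx hx.1
  have h₂ := h.antitone_far hx (right_mem_Icc.2 hLU) hx.2
  rw [abs_le]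
  constructor <;> linarith

end SecantBounds

namespace GhostRow

variable {ι : Type*} (R : GhostRow ι) {η : ℝ → ℝ} {r s : ι → ℝ} {rL rU m L M D : ℝ}

lemma energy_sub_le_of_le (h : SecantBounds η rL rU m L M) (hr : ∀ j, r j ∈ Icc rL rU)
    (hs : ∀ j, s j ∈ Icc rL rU) (hrs : r ≤ s) :
    R.energy η s - R.energy η r ≤ L * (s R.c - r R.c) := by
  obtain ⟨a, -, haL, e⟩ := h.near _ (hs R.c) _ (hr R.c)
  have hα := mul_le_mul_of_nonneg_left (h.antitone_far (two_mul_mem_Icc_two_mul (hr R.c))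
    (two_mul_mem_Icc_two_mul (hs R.c)) (by linarith [hrs R.c])) R.α_nonneg
  have hβ := mul_le_mul_of_nonneg_left (h.antitone_far (add_mem_Icc_two_mul (hr R.c) (hr R.p))
    (add_mem_Icc_two_mul (hs R.c) (hs R.p)) (by linarith [hrs R.c, hrs R.p])) R.β_nonneg
  have hγ := mul_le_mul_of_nonneg_left (h.antitone_far (add_mem_Icc_two_mul (hr R.c) (hr R.q))
    (add_mem_Icc_two_mul (hs R.c) (hs R.q)) (by linarith [hrs R.c, hrs R.q])) R.γ_nonneg
  have ha := mul_le_mul_of_nonneg_right haL (sub_nonneg.2 (hrs R.c))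
  unfold energy
  linarith

lemma energy_sub_ge (h : SecantBounds η rL rU m L M) (hM : 0 ≤ M) (hr : ∀ j, r j ∈ Icc rL rU)
    (hs : ∀ j, s j ∈ Icc rL rU) (hrs : s R.c ≤ r R.c)
    (hmax : ∀ j, |r j - s j| ≤ r R.c - s R.c) :
    (m - 5 * M) * (r R.c - s R.c) ≤ R.energy η r - R.energy η s := by
  obtain ⟨a, hma, -, e⟩ := h.near _ (hr R.c) _ (hs R.c)
  have hu := sub_nonneg.2 hrs
  have ha := mul_le_mul_of_nonneg_right hma hu
  have hsum : ∀ j, |r R.c + r j - (s R.c + s j)| ≤ 2 * (r R.c - s R.c) := fun j => by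
    have := abs_le.1 (hmax j)
    rw [abs_le]
    constructor <;> linarith
  have hα := mul_le_mul_of_nonneg_left (abs_le.1 (h.abs_far_le (two_mul_mem_Icc_two_mul (hr R.c))
    (two_mul_mem_Icc_two_mul (hs R.c)) (by simpa [two_mul] using hsum R.c))).1 R.α_nonneg
  have hβ := mul_le_mul_of_nonneg_left (abs_le.1 (h.abs_far_le (add_mem_Icc_two_mul (hr R.c)
    (hr R.p)) (add_mem_Icc_two_mul (hs R.c) (hs R.p)) (hsum R.p))).1 R.β_nonneg
  have hγ := mul_le_mul_of_nonneg_left (abs_le.1 (h.abs_far_le (add_mem_Icc_two_mul (hr R.c)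
    (hr R.q)) (add_mem_Icc_two_mul (hs R.c) (hs R.q)) (hsum R.q))).1 R.γ_nonneg
  have hc := mul_le_mul_of_nonneg_right R.energy_le (mul_nonneg hM hu)
  unfold energy
  linarith

lemma abs_energy_sub_ge (h : SecantBounds η rL rU m L M) (hM : 0 ≤ M)
    (hr : ∀ j, r j ∈ Icc rL rU) (hs : ∀ j, s j ∈ Icc rL rU)
    (hmax : ∀ j, |r j - s j| ≤ |r R.c - s R.c|) :
    (m - 5 * M) * |r R.c - s R.c| ≤ |R.energy η r - R.energy η s| := by
  rcases le_total (s R.c) (r R.c) with hrs | hrs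
  · rw [abs_of_nonneg (sub_nonneg.2 hrs)] at hmax ⊢
    exact (R.energy_sub_ge h hM hr hs hrs hmax).trans (le_abs_self _)
  · simp only [abs_sub_comm (r _)] at hmax ⊢
    rw [abs_of_nonneg (sub_nonneg.2 hrs)] at hmax ⊢
    rw [abs_sub_comm]
    exact (R.energy_sub_ge h hM hs hr hrs hmax).trans (le_abs_self _)

lemma abs_interface_sub_le (h : SecantBounds η rL rU m L M) (hr : ∀ j, r j ∈ Icc rL rU)
    (hs : ∀ j, s j ∈ Icc rL rU) (hD : ∀ j, |r j - s j| ≤ D) (k k₁ k₂ : ι) :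
    |(2 * η (2 * r k) - η (r k + r k₁) - η (r k + r k₂))
      - (2 * η (2 * s k) - η (s k + s k₁) - η (s k + s k₂))| ≤ 4 * M * D := by
  obtain ⟨a, ha, haM, ea⟩ := h.far _ (two_mul_mem_Icc_two_mul (hr k)) _
    (two_mul_mem_Icc_two_mul (hs k))
  obtain ⟨b, hb, hbM, eb⟩ := h.far _ (add_mem_Icc_two_mul (hr k) (hr k₁)) _
    (add_mem_Icc_two_mul (hs k) (hs k₁))
  obtain ⟨c, hc, hcM, ec⟩ := h.far _ (add_mem_Icc_two_mul (hr k) (hr k₂)) _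
    (add_mem_Icc_two_mul (hs k) (hs k₂))
  have hD0 := (abs_nonneg _).trans (hD k)
  calc _ = |(b + c - 4 * a) * (r k - s k) + (b * (r k₁ - s k₁) + c * (r k₂ - s k₂))| := by
        congr 1
        linear_combination 2 * ea - eb - ec
    _ ≤ |b + c - 4 * a| * |r k - s k| + (b * |r k₁ - s k₁| + c * |r k₂ - s k₂|) := by
        refine (abs_add_le _ _).trans (add_le_add (abs_mul _ _).le ((abs_add_le _ _).trans ?_))
        rw [abs_mul, abs_mul, abs_of_nonneg hb, abs_of_nonneg hc]
    _ ≤ |b + c - 4 * a| * D + (b * D + c * D) := by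
        gcongr <;> apply hD
    _ = (|b + c - 4 * a| + b + c) * D := by ring
    _ ≤ 4 * M * D := by
        refine mul_le_mul_of_nonneg_right ?_ hD0
        rcases abs_cases (b + c - 4 * a) with ⟨e, -⟩ | ⟨e, -⟩ <;> rw [e] <;> linarith

lemma abs_ghost_sub_le (h : SecantBounds η rL rU m L M) (hM : 0 ≤ M)
    (hr : ∀ j, r j ∈ Icc rL rU) (hs : ∀ j, s j ∈ Icc rL rU) (hD : ∀ j, |r j - s j| ≤ D) :
    |R.ghost η r - R.ghost η s| ≤ 8 * M * D := by
  have hD0 := (abs_nonneg _).trans (hD R.c)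
  have hsum : ∀ j, |r R.c + r j - (s R.c + s j)| ≤ 2 * D := fun j => by
    have h₁ := abs_le.1 (hD j)
    have h₂ := abs_le.1 (hD R.c)
    rw [abs_le]
    constructor <;> linarith
  have hδ := h.abs_far_le (two_mul_mem_Icc_two_mul (hr R.c))
    (two_mul_mem_Icc_two_mul (hs R.c)) (by simpa [two_mul] using hsum R.c)
  have hε := h.abs_far_le (add_mem_Icc_two_mul (hr R.c) (hr R.p))
    (add_mem_Icc_two_mul (hs R.c) (hs R.p)) (hsum R.p)
  have hζ := h.abs_far_le (add_mem_Icc_two_mul (hr R.c) (hr R.q))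
    (add_mem_Icc_two_mul (hs R.c) (hs R.q)) (hsum R.q)
  have hθ := abs_interface_sub_le h hr hs hD R.k R.k₁ R.k₂
  have hθ0 := R.θ_nonneg
  unfold ghost
  generalize 2 * η (2 * r R.k) - η (r R.k + r R.k₁) - η (r R.k + r R.k₂) = t at *
  generalize 2 * η (2 * s R.k) - η (s R.k + s R.k₁) - η (s R.k + s R.k₂) = t' at *
  calc _ = |R.δ * (η (2 * r R.c) - η (2 * s R.c))
            + R.ε * (η (r R.c + r R.p) - η (s R.c + s R.p))
            + R.ζ * (η (r R.c + r R.q) - η (s R.c + s R.q)) + R.θ * (t - t')| := by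
        congr 1
        ring
    _ ≤ |R.δ| * (2 * M * D) + |R.ε| * (2 * M * D) + |R.ζ| * (2 * M * D)
          + R.θ * (4 * M * D) := by
        refine (abs_add_le _ _).trans (add_le_add ((abs_add_le _ _).trans
          (add_le_add ((abs_add_le _ _).trans (add_le_add ?_ ?_)) ?_)) ?_) <;>
        rw [abs_mul] <;> [skip; skip; skip; rw [abs_of_nonneg hθ0]] <;> gcongr
    _ = (|R.δ| + |R.ε| + |R.ζ| + 2 * R.θ) * (2 * M * D) := by ring
    _ ≤ 4 * (2 * M * D) := mul_le_mul_of_nonneg_right R.ghost_le (by positivity)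
    _ = 8 * M * D := by ring

/-- The energy-based part of a row on a constant vector. -/
lemma energy_const (x : ℝ) :
    R.energy η (fun _ => x) = η x + (R.α + R.β + R.γ) * η (2 * x) := by
  unfold energy
  rw [← two_mul]
  ring

lemma abs_ghost_sub_le_midpoint (h : SecantBounds η rL rU m L M) (hr : ∀ j, r j ∈ Icc rL rU) :
    |R.ghost η r - (R.δ + R.ε + R.ζ) * ((η (2 * rL) + η (2 * rU)) / 2)| ≤
      (|R.δ| + |R.ε| + |R.ζ| + 4 * R.θ) * ((η (2 * rL) - η (2 * rU)) / 2) := by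
  have hδ := h.abs_far_sub_midpoint_le (two_mul_mem_Icc_two_mul (hr R.c))
  have hε := h.abs_far_sub_midpoint_le (add_mem_Icc_two_mul (hr R.c) (hr R.p))
  have hζ := h.abs_far_sub_midpoint_le (add_mem_Icc_two_mul (hr R.c) (hr R.q))
  have h₀ := abs_le.1 (h.abs_far_sub_midpoint_le (two_mul_mem_Icc_two_mul (hr R.k)))
  have h₁ := abs_le.1 (h.abs_far_sub_midpoint_le (add_mem_Icc_two_mul (hr R.k) (hr R.k₁)))
  have h₂ := abs_le.1 (h.abs_far_sub_midpoint_le (add_mem_Icc_two_mul (hr R.k) (hr R.k₂)))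
  unfold ghost
  generalize (η (2 * rL) + η (2 * rU)) / 2 = C at *
  generalize (η (2 * rL) - η (2 * rU)) / 2 = H at *
  have hθ : |2 * η (2 * r R.k) - η (r R.k + r R.k₁) - η (r R.k + r R.k₂)| ≤ 4 * H := by
    rw [abs_le]
    constructor <;> linarith
  have hθ0 := R.θ_nonneg
  generalize 2 * η (2 * r R.k) - η (r R.k + r R.k₁) - η (r R.k + r R.k₂) = t at *
  calc _ = |R.δ * (η (2 * r R.c) - C) + R.ε * (η (r R.c + r R.p) - C)
            + R.ζ * (η (r R.c + r R.q) - C) + R.θ * t| := by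
        congr 1
        ring
    _ ≤ |R.δ| * H + |R.ε| * H + |R.ζ| * H + R.θ * (4 * H) := by
        refine (abs_add_le _ _).trans (add_le_add ((abs_add_le _ _).trans
          (add_le_add ((abs_add_le _ _).trans (add_le_add ?_ ?_)) ?_)) ?_) <;>
        rw [abs_mul] <;> [skip; skip; skip; rw [abs_of_nonneg hθ0]] <;> gcongr
    _ = (|R.δ| + |R.ε| + |R.ζ| + 4 * R.θ) * H := by ring

lemma energy_const_left_add_ghost_le (h : SecantBounds η rL rU m L M)
    (hr : ∀ j, r j ∈ Icc rL rU) :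
    R.energy η (fun _ => rL) + R.ghost η r ≤ η rL + 4 * η (2 * rL) - 2 * η (2 * rU) := by
  have hg := (abs_le.1 (R.abs_ghost_sub_le_midpoint h hr)).2
  have hH := (abs_nonneg _).trans (h.abs_far_sub_midpoint_le (two_mul_mem_Icc_two_mul (hr R.c)))
  have ht := mul_le_mul_of_nonneg_right R.total_le hH
  rw [energy_const]
  rw [show R.δ + R.ε + R.ζ = 2 - (R.α + R.β + R.γ) by linarith [R.total_eq]] at hg
  linarith

lemma le_energy_const_right_add_ghost (h : SecantBounds η rL rU m L M)
    (hr : ∀ j, r j ∈ Icc rL rU) :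
    η rU + 4 * η (2 * rU) - 2 * η (2 * rL) ≤ R.energy η (fun _ => rU) + R.ghost η r := by
  have hg := (abs_le.1 (R.abs_ghost_sub_le_midpoint h hr)).1
  have hH := (abs_nonneg _).trans (h.abs_far_sub_midpoint_le (two_mul_mem_Icc_two_mul (hr R.c)))
  have ht := mul_le_mul_of_nonneg_right R.total_le hH
  rw [energy_const]
  rw [show R.δ + R.ε + R.ζ = 2 - (R.α + R.β + R.γ) by linarith [R.total_eq]] at hg
  linarith

/-- If `b` lies strictly between the values of the energy-based rows at the two corners of the
box, the system `energy = b` has a solution in the open box, namely a fixed point of the monotone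
map `r ↦ r - (energy r - b) / L`. -/
theorem exists_energy_eq (R : ι → GhostRow ι) (hR : ∀ i, (R i).c = i)
    (h : SecantBounds η rL rU m L M) (hL : 0 < L) (hLU : rL ≤ rU) (b : ι → ℝ)
    (hb : ∀ i, (R i).energy η (fun _ => rL) < b i ∧ b i < (R i).energy η (fun _ => rU)) :
    ∃ r : ι → ℝ, (∀ j, r j ∈ Ioo rL rU) ∧ ∀ i, (R i).energy η r = b i := by
  have hmono : ∀ r s : ι → ℝ, (∀ j, r j ∈ Icc rL rU) → (∀ j, s j ∈ Icc rL rU) → r ≤ s →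
      ∀ i, r i - ((R i).energy η r - b i) / L ≤ s i - ((R i).energy η s - b i) / L := by
    intro r s hr hs hrs i
    have he := (R i).energy_sub_le_of_le h hr hs hrs
    rw [hR, mul_comm, ← div_le_iff₀ hL, sub_div] at he
    simp only [sub_div]
    linarith
  have hmem : ∀ r : ι → ℝ, (∀ j, r j ∈ Icc rL rU) →
      ∀ i, r i - ((R i).energy η r - b i) / L ∈ Ioo rL rU := by
    intro r hr i
    have hl := hmono (fun _ => rL) r (fun _ => left_mem_Icc.2 hLU) hr (fun j => (hr j).1) i
    have hu := hmono r (fun _ => rU) hr (fun _ => right_mem_Icc.2 hLU) (fun j => (hr j).2) i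
    have hl' := div_neg_of_neg_of_pos (sub_neg.2 (hb i).1) hL
    have hu' := div_pos (sub_pos.2 (hb i).2) hL
    constructor <;> linarith
  have : Fact (rL ≤ rU) := ⟨hLU⟩
  let F : (ι → Icc rL rU) →o (ι → Icc rL rU) :=
    { toFun := fun r i => ⟨r i - ((R i).energy η (fun j => r j) - b i) / L,
        Ioo_subset_Icc_self (hmem (fun j => r j) (fun j => (r j).2) i)⟩
      monotone' := fun r s hrs i => hmono _ _ (fun j => (r j).2) (fun j => (s j).2) hrs i }
  obtain ⟨ρ, hρ⟩ : ∃ ρ, F ρ = ρ := ⟨_, F.map_lfp⟩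
  have hfix : ∀ i, (ρ i : ℝ) - ((R i).energy η (fun j => ρ j) - b i) / L = ρ i :=
    fun i => congrArg Subtype.val (congrFun hρ i)
  refine ⟨fun j => ρ j, fun j => ?_, fun i => ?_⟩
  · simpa only [hfix] using hmem (fun j => ρ j) (fun j => (ρ j).2) j
  · have := hfix i
    rw [sub_eq_self, div_eq_zero_iff, or_iff_left hL.ne'] at this
    exact sub_eq_zero.1 this

end GhostRow

lemma vcomp_of_add_eq (N : ℕ) (r : Fin (2 * N + 1) → ℝ) {j : ℤ} (k : Fin (2 * N + 1))
    (hk : j + N = k.val) : vcomp N r j = r k := by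
  have : (j + N).toNat = k.val := by omega
  simp only [vcomp, this, k.isLt, dite_true]

set_option maxHeartbeats 1000000 in
/-- Every component of `Ψ̂^E` and `Ψ̂^G` has the shape described by `GhostRow`. -/
theorem exists_ghostRow {N K : ℕ} (hK : 2 ≤ K) (hKN : K + 2 ≤ N) (i : Fin (2 * N + 1)) :
    ∃ R : GhostRow (Fin (2 * N + 1)), R.c = i ∧ (∀ η r, PsiE N K η r i = R.energy η r) ∧
      ∀ η r, PsiG N K η r i = R.ghost η r := by
  have hi := i.isLt
  have hc : ∀ r, vcomp N r ((i.val : ℤ) - N) = r i := fun r => vcomp_of_add_eq N r i (by simp)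
  by_cases hnear : N ≤ i.val + (K + 1) ∧ i.val ≤ N + (K + 1)
  swap
  · refine ⟨⟨i, i, i, i, i, i, 2, 0, 0, 0, 0, 0, 0, ?_, ?_, ?_, ?_, ?_, ?_, ?_, ?_⟩, rfl,
      fun η r => ?_, fun η r => ?_⟩
    iterate 8 norm_num
    all_goals
      simp only [PsiE, PsiG, PsiF, GhostRow.energy, GhostRow.ghost, hc]
      split_ifs <;> first | omega | ring
  obtain ⟨p, hp⟩ : ∃ p : Fin (2 * N + 1), p.val + 1 = i.val :=
    ⟨⟨i.val - 1, by omega⟩, Nat.sub_add_cancel (by omega)⟩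
  obtain ⟨q, hq⟩ : ∃ q : Fin (2 * N + 1), q.val = i.val + 1 := ⟨⟨i.val + 1, by omega⟩, rfl⟩
  obtain ⟨k, hk⟩ : ∃ k : Fin (2 * N + 1), k.val = N + K := ⟨⟨N + K, by omega⟩, rfl⟩
  obtain ⟨k₁, hk₁⟩ : ∃ k : Fin (2 * N + 1), k.val + 1 = N + K :=
    ⟨⟨N + K - 1, by omega⟩, Nat.sub_add_cancel (by omega)⟩
  obtain ⟨k₂, hk₂⟩ : ∃ k : Fin (2 * N + 1), k.val = N + K + 1 := ⟨⟨N + K + 1, by omega⟩, rfl⟩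
  have hcp : ∀ r, vcomp N r ((i.val : ℤ) - N - 1) = r p :=
    fun r => vcomp_of_add_eq N r p (by omega)
  have hcq : ∀ r, vcomp N r ((i.val : ℤ) - N + 1) = r q :=
    fun r => vcomp_of_add_eq N r q (by omega)
  have hck : ∀ r, vcomp N r (K : ℤ) = r k := fun r => vcomp_of_add_eq N r k (by omega)
  have hck₁ : ∀ r, vcomp N r ((K : ℤ) - 1) = r k₁ := fun r => vcomp_of_add_eq N r k₁ (by omega)
  have hck₂ : ∀ r, vcomp N r ((K : ℤ) + 1) = r k₂ := fun r => vcomp_of_add_eq N r k₂ (by omega)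
  have hcases : N = i.val + (K + 1) ∨ i.val = N + (K + 1) ∨ (N = i.val + K ∨ i.val = N + K) ∨
      N + 1 = i.val + K ∨ i.val + 1 = N + K ∨ (N + 2 ≤ i.val + K ∧ i.val + 2 ≤ N + K) := by
    omega
  rcases hcases with h | h | h | h | h | h
  · refine ⟨⟨i, p, q, k, k₁, k₂, 2, 0, 1 / 2, 0, 0, -(1 / 2), 0,
      ?_, ?_, ?_, ?_, ?_, ?_, ?_, ?_⟩, rfl, fun η r => ?_, fun η r => ?_⟩
    iterate 8 norm_num [abs_inv]
    all_goals
      simp only [PsiE, PsiG, PsiF, GhostRow.energy, GhostRow.ghost, hc, hcq]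
      split_ifs <;> first | omega | ring
  · refine ⟨⟨i, p, q, k, k₁, k₂, 2, 1 / 2, 0, 0, -(1 / 2), 0, 0,
      ?_, ?_, ?_, ?_, ?_, ?_, ?_, ?_⟩, rfl, fun η r => ?_, fun η r => ?_⟩
    iterate 8 norm_num [abs_inv]
    all_goals
      simp only [PsiE, PsiG, PsiF, GhostRow.energy, GhostRow.ghost, hc, hcp, add_comm (r p)]
      split_ifs <;> first | omega | ring
  · refine ⟨⟨i, p, q, k, k₁, k₂, 1, 1 / 2, 1 / 2, 1, -(1 / 2), -(1 / 2), 0,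
      ?_, ?_, ?_, ?_, ?_, ?_, ?_, ?_⟩, rfl, fun η r => ?_, fun η r => ?_⟩
    iterate 8 norm_num [abs_inv]
    all_goals
      simp only [PsiE, PsiG, PsiF, GhostRow.energy, GhostRow.ghost, hc, hcp, hcq]
      split_ifs <;> first | omega | ring
  · refine ⟨⟨i, p, q, k, k₁, k₂, 0, 1 / 2, 1, 0, 1 / 2, 0, 1,
      ?_, ?_, ?_, ?_, ?_, ?_, ?_, ?_⟩, rfl, fun η r => ?_, fun η r => ?_⟩
    iterate 8 norm_num [abs_inv]
    all_goals
      simp only [PsiE, PsiG, PsiF, GhostRow.energy, GhostRow.ghost, hc, hcp, hcq, hck, hck₁, hck₂]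
      split_ifs <;> first | omega | ring
  · refine ⟨⟨i, p, q, k, k₁, k₂, 0, 1, 1 / 2, 0, 0, 1 / 2, 1,
      ?_, ?_, ?_, ?_, ?_, ?_, ?_, ?_⟩, rfl, fun η r => ?_, fun η r => ?_⟩
    iterate 8 norm_num [abs_inv]
    all_goals
      simp only [PsiE, PsiG, PsiF, GhostRow.energy, GhostRow.ghost, hc, hcp, hcq, hck, hck₁, hck₂]
      split_ifs <;> first | omega | ring
  · refine ⟨⟨i, p, q, k, k₁, k₂, 0, 1, 1, 0, 0, 0, 1,
      ?_, ?_, ?_, ?_, ?_, ?_, ?_, ?_⟩, rfl, fun η r => ?_, fun η r => ?_⟩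
    iterate 8 norm_num [abs_inv]
    all_goals
      simp only [PsiE, PsiG, PsiF, GhostRow.energy, GhostRow.ghost, hc, hcp, hcq, hck, hck₁, hck₂]
      split_ifs <;> first | omega | ring

/-- Mean value theorem in secant form, for points in either order. -/
lemma exists_deriv_mul_eq_sub {f : ℝ → ℝ} {a b : ℝ}
    (hf : ∀ z ∈ Icc a b, DifferentiableAt ℝ f z) {x y : ℝ} (hx : x ∈ Icc a b) (hy : y ∈ Icc a b) :
    ∃ z ∈ Icc a b, f x - f y = deriv f z * (x - y) := by
  wlog hxy : y ≤ x generalizing x y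
  · obtain ⟨z, hz, e⟩ := this hy hx (le_of_not_ge hxy)
    exact ⟨z, hz, by linear_combination -e⟩
  rcases hxy.eq_or_lt with rfl | hlt
  · exact ⟨y, hy, by ring⟩
  have hsub : Icc y x ⊆ Icc a b := Icc_subset_Icc hy.1 hx.2
  obtain ⟨z, hz, e⟩ := exists_deriv_eq_slope f hlt
    (fun w hw => (hf w (hsub hw)).continuousAt.continuousWithinAt)
    (fun w hw => (hf w (hsub (Ioo_subset_Icc_self hw))).differentiableWithinAt)
  refine ⟨z, hsub (Ioo_subset_Icc_self hz), ?_⟩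
  rw [e, div_mul_cancel₀ _ (sub_pos.2 hlt).ne']

lemma Assump.secantBounds {η : ℝ → ℝ} {r1 r2 a0 a1 rL rU : ℝ} (hA : Assump η r1 r2 a0 a1)
    (hη : ContDiffOn ℝ 2 η (Ioi 0)) (h1 : r2 / 2 < rL) (hU : rU ≤ r1) :
    SecantBounds η rL rU (deriv η rU) (deriv η rL) |deriv η (2 * rL)| := by
  obtain ⟨ha0, ha0r1, hr12, -, -, -, hneg, hconc, hconv, -⟩ := hA
  have hdiff : ∀ z, 0 < z → DifferentiableAt ℝ η z := fun z hz =>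
    (hη.differentiableOn (by norm_num)).differentiableAt (Ioi_mem_nhds hz)
  have hη' : ContDiffOn ℝ 1 (deriv η) (Ioi 0) := hη.deriv_of_isOpen isOpen_Ioi (by norm_num)
  have hdiff' : DifferentiableOn ℝ (deriv η) (Ioi 0) := hη'.differentiableOn (by norm_num)
  have hL : 0 < rL := by linarith
  have hnearsub : Icc rL rU ⊆ Ioi 0 := fun z hz => hL.trans_le hz.1
  have hfarsub : Ici (2 * rL) ⊆ Ioi 0 := fun z hz =>
    (by linarith : (0 : ℝ) < 2 * rL).trans_le hz
  have hanti : AntitoneOn (deriv η) (Icc rL rU) := by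
    refine antitoneOn_of_deriv_nonpos (convex_Icc _ _) (hη'.continuousOn.mono hnearsub)
      (hdiff'.mono (interior_subset.trans hnearsub)) fun z hz => (hconc z ?_).le
    have hz := interior_subset hz
    exact ⟨hnearsub hz, by linarith [hz.2]⟩
  have hmono : MonotoneOn (deriv η) (Ici (2 * rL)) := by
    refine monotoneOn_of_deriv_nonneg (convex_Ici _) (hη'.continuousOn.mono hfarsub)
      (hdiff'.mono (interior_subset.trans hfarsub)) fun z hz => (hconv z ?_).le
    have hz : 2 * rL ≤ z := interior_subset hz
    exact lt_of_lt_of_le (by linarith) hz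
  refine ⟨fun x hx y hy => ?_, fun x hx y hy => ?_⟩
  · obtain ⟨z, hz, e⟩ := exists_deriv_mul_eq_sub (fun z hz => hdiff z (hnearsub hz)) hx hy
    have hLU := hz.1.trans hz.2
    exact ⟨_, hanti hz (right_mem_Icc.2 hLU) hz.2, hanti (left_mem_Icc.2 hLU) hz hz.1, e⟩
  · obtain ⟨z, hz, e⟩ := exists_deriv_mul_eq_sub (fun z hz => hdiff z (hfarsub hz.1)) hx hy
    have hz' : deriv η z < 0 := hneg z (lt_of_lt_of_le (by linarith) hz.1)
    refine ⟨-deriv η z, by linarith, ?_, by rw [e, neg_neg]⟩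
    exact (neg_le_neg (hmono (mem_Ici.2 le_rfl) (mem_Ici.2 hz.1) hz.1)).trans (neg_le_abs _)

/-- Theorem (ghost force iteration): under the stated hypotheses, each step of the ghost force
iteration `Ψ̂^E(rⁿ⁺¹) + Ψ̂^G(rⁿ) = Φ` has a unique solution in `Ω = (r_L,r_U)^{2N+1}`, and the
induced map is a contraction in the max norm with the stated constant. -/
theorem ghost_force_iteration_contraction
    (N K : ℕ) (hK : 2 ≤ K) (hKN : K + 2 ≤ N)
    (φ η : ℝ → ℝ) (hφ : ContDiffOn ℝ 3 φ (Set.Ioi 0)) (hη : η = deriv φ)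
    (r1 r2 a0 a1 : ℝ) (hA : Assump η r1 r2 a0 a1)
    (rL rU : ℝ) (h1 : r2/2 < rL) (h2 : rL < rU)
    (h3 : 0 < deriv η rU + 13 * deriv η (2*rL))
    (Φ : Fin (2*N+1) → ℝ)
    (hΦ : ∀ j, η rL + 4*η (2*rL) - 2*η (2*rU) < Φ j ∧
               Φ j < η rU + 4*η (2*rU) - 2*η (2*rL)) :
    (∀ rn : Fin (2*N+1) → ℝ, (∀ k, rn k ∈ Ioo rL rU) →
      ∃! rn1 : Fin (2*N+1) → ℝ, (∀ k, rn1 k ∈ Ioo rL rU) ∧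
        (∀ i, PsiE N K η rn1 i + PsiG N K η rn i = Φ i)) ∧
    8 * |deriv η (2*rL)| / (deriv η rU - 5 * |deriv η (2*rL)|) < 1 ∧
    ∀ rn sn rn1 sn1 : Fin (2*N+1) → ℝ,
      (∀ k, rn k ∈ Ioo rL rU) → (∀ k, sn k ∈ Ioo rL rU) →
      (∀ k, rn1 k ∈ Ioo rL rU) → (∀ k, sn1 k ∈ Ioo rL rU) →
      (∀ i, PsiE N K η rn1 i + PsiG N K η rn i = Φ i) →
      (∀ i, PsiE N K η sn1 i + PsiG N K η sn i = Φ i) →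
      ‖rn1 - sn1‖ ≤ 8 * |deriv η (2*rL)| / (deriv η rU - 5 * |deriv η (2*rL)|) * ‖rn - sn‖ := by
  have hA' := hA
  obtain ⟨ha0, ha0r1, hr12, -, -, -, hneg, -⟩ := hA'
  have hneg2 : deriv η (2 * rL) < 0 := hneg _ (show r1 < 2 * rL by linarith)
  have hU : rU ≤ r1 := by
    by_contra! hlt
    linarith [hneg rU hlt]
  have hηC : ContDiffOn ℝ 2 η (Ioi 0) := by
    rw [hη]
    exact hφ.deriv_of_isOpen isOpen_Ioi (by norm_num)
  have hS := hA.secantBounds hηC h1 hU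
  have hM : |deriv η (2 * rL)| = -deriv η (2 * rL) := abs_of_neg hneg2
  have hM0 : 0 ≤ |deriv η (2 * rL)| := abs_nonneg _
  have hden : 0 < deriv η rU - 5 * |deriv η (2 * rL)| := by linarith
  have hL : 0 < deriv η rL := by
    obtain ⟨a, hma, haL, -⟩ := hS.near rL (left_mem_Icc.2 h2.le) rL (left_mem_Icc.2 h2.le)
    linarith
  choose R hRc hRE hRG using exists_ghostRow hK hKN
  have hcontr : ∀ rn sn rn1 sn1 : Fin (2*N+1) → ℝ,
      (∀ k, rn k ∈ Ioo rL rU) → (∀ k, sn k ∈ Ioo rL rU) →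
      (∀ k, rn1 k ∈ Ioo rL rU) → (∀ k, sn1 k ∈ Ioo rL rU) →
      (∀ i, PsiE N K η rn1 i + PsiG N K η rn i = Φ i) →
      (∀ i, PsiE N K η sn1 i + PsiG N K η sn i = Φ i) →
      ‖rn1 - sn1‖ ≤
        8 * |deriv η (2*rL)| / (deriv η rU - 5 * |deriv η (2*rL)|) * ‖rn - sn‖ := by
    intro rn sn rn1 sn1 hrn hsn hrn1 hsn1 er es
    obtain ⟨i, hi⟩ := Finite.exists_max fun j => |rn1 j - sn1 j|
    have hE := (R i).abs_energy_sub_ge hS hM0 (fun j => Ioo_subset_Icc_self (hrn1 j))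
      (fun j => Ioo_subset_Icc_self (hsn1 j)) (by rwa [hRc])
    have hG := (R i).abs_ghost_sub_le hS hM0 (fun j => Ioo_subset_Icc_self (hrn j))
      (fun j => Ioo_subset_Icc_self (hsn j)) (fun j => norm_le_pi_norm (rn - sn) j)
    have e : (R i).energy η rn1 - (R i).energy η sn1
        = -((R i).ghost η rn - (R i).ghost η sn) := by
      rw [← hRE, ← hRE, ← hRG, ← hRG]
      linarith [er i, es i]
    rw [e, abs_neg, hRc] at hE
    have hnorm : ‖rn1 - sn1‖ ≤ |rn1 i - sn1 i| :=
      (pi_norm_le_iff_of_nonneg (abs_nonneg _)).2 hi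
    refine hnorm.trans ?_
    rw [div_mul_eq_mul_div, le_div_iff₀ hden, mul_comm]
    exact hE.trans hG
  refine ⟨fun rn hrn => ?_, by rw [div_lt_one hden]; linarith, hcontr⟩
  have hrn' := fun j => Ioo_subset_Icc_self (hrn j)
  obtain ⟨rn1, hmem, heq⟩ := GhostRow.exists_energy_eq R hRc hS hL h2.le
    (fun i => Φ i - PsiG N K η rn i) fun i => by
      have hlo := (R i).energy_const_left_add_ghost_le hS hrn'
      have hhi := (R i).le_energy_const_right_add_ghost hS hrn'
      rw [hRG]
      constructor <;> linarith [(hΦ i).1, (hΦ i).2]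
  have hsol : ∀ i, PsiE N K η rn1 i + PsiG N K η rn i = Φ i := fun i => by
    rw [hRE, heq, sub_add_cancel]
  refine ⟨rn1, ⟨hmem, hsol⟩, fun s ⟨hs, es⟩ => ?_⟩
  have hzero := hcontr rn rn s rn1 hrn hrn hs hmem es hsol
  rw [sub_self, norm_zero, mul_zero] at hzero
  exact sub_eq_zero.1 (norm_le_zero_iff.1 hzero)
end
end
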